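/- There exist D ∈ ℕ, a constant c > 0, and a sequence of finite connected simple graphs G_n = (V_n, E_n) with 2 ≤ deg(v) ≤ D for every vertex v and |V_n| → ∞, such that the 1/4 total variation mixing time of the lazy non-backtracking random walk on G_n is at least c·log|V_n|·t_mix(G_n) for all n. -/

import Mathlib

open Filter Finset

noncomputable section

variable {V : Type} [Fintype V] [DecidableEq V]

/-- `P` is a row-stochastic matrix. -/
def IsStoch (P : Matrix V V ℝ) : Prop :=
  (∀ i j, 0 ≤ P i j) ∧ ∀ i, ∑ j, P i j = 1

/-- `π` is a probability vector with full support. -/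
def IsProb (π : V → ℝ) : Prop := (∀ i, 0 < π i) ∧ ∑ i, π i = 1

/-- reversibility: `π x * P x y = π y * P y x`. -/
def Rev (P : Matrix V V ℝ) (π : V → ℝ) : Prop := ∀ i j, π i * P i j = π j * P j i

/-- irreducibility -/
def Irred (P : Matrix V V ℝ) : Prop := ∀ i j, ∃ t : ℕ, 0 < (P ^ t) i j

/-- the lazy version `(I + P)/2` of a chain -/
def lazyM (P : Matrix V V ℝ) : Matrix V V ℝ := (2 : ℝ)⁻¹ • (1 + P)

/-- total variation distance -/
def tvDist (μ ν : V → ℝ) : ℝ := (∑ x, |μ x - ν x|) / 2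

/-- worst-case total variation distance from stationarity at time `t` -/
def dTV (P : Matrix V V ℝ) (π : V → ℝ) (t : ℕ) : ℝ := ⨆ x, tvDist ((P ^ t) x) π

/-- the `ε` total-variation mixing time -/
def mixTime (P : Matrix V V ℝ) (π : V → ℝ) (ε : ℝ) : ℕ := sInf {t : ℕ | dTV P π t ≤ ε}

/-- worst-case separation distance at time `t` -/
def dSep (P : Matrix V V ℝ) (π : V → ℝ) (t : ℕ) : ℝ := 1 - ⨅ x, ⨅ y, ((P ^ t) x y) / π y

/-- the `ε` separation time -/
def sepTime (P : Matrix V V ℝ) (π : V → ℝ) (ε : ℝ) : ℕ := sInf {t : ℕ | dSep P π t ≤ ε}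

/-- the heat kernel `H_t = exp (t (P - I))` of the associated continuous-time chain -/
def heatKer (P : Matrix V V ℝ) (t : ℝ) : Matrix V V ℝ :=
  ∑' k : ℕ, (t ^ k / (Nat.factorial k : ℝ)) • ((P - 1) ^ k)

/-- separation distance of the continuous-time chain -/
def dSepC (P : Matrix V V ℝ) (π : V → ℝ) (t : ℝ) : ℝ := 1 - ⨅ x, ⨅ y, (heatKer P t) x y / π y

/-- the `ε` separation time of the continuous-time chain -/
def sepTimeC (P : Matrix V V ℝ) (π : V → ℝ) (ε : ℝ) : ℝ := sInf {t : ℝ | 0 ≤ t ∧ dSepC P π t ≤ ε}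

/-- degree of a vertex -/
def deg (G : SimpleGraph V) (v : V) : ℕ := Nat.card {u // G.Adj v u}

open Classical in
/-- transition matrix of the lazy simple random walk on `G` -/
def walkMat (G : SimpleGraph V) : Matrix V V ℝ :=
  Matrix.of fun v u => if v = u then 1/2 else if G.Adj v u then 1 / (2 * (deg G v : ℝ)) else 0

/-- stationary distribution of the (lazy) simple random walk on `G` -/
def degSta (G : SimpleGraph V) (v : V) : ℝ := (deg G v : ℝ) / ∑ u, (deg G u : ℝ)

/-- the `ε` total-variation mixing time of the lazy simple random walk on `G` -/
def tmixG (G : SimpleGraph V) (ε : ℝ) : ℕ := mixTime (walkMat G) (degSta G) ε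

/-- the second largest eigenvalue of a reversible transition matrix -/
def lam2 (P : Matrix V V ℝ) : ℝ :=
  sSup {μ : ℝ | μ ≠ 1 ∧ ∃ f : V → ℝ, f ≠ 0 ∧ P.mulVec f = μ • f}

/-- the relaxation time `1/(1-λ₂)` -/
def trel (P : Matrix V V ℝ) : ℝ := 1 / (1 - lam2 P)

/-- the relaxation time of the lazy simple random walk on `G` -/
def trelG (G : SimpleGraph V) : ℝ := trel (walkMat G)

/-- transition matrix of the lazy random walk on the network with edge weights `w` -/
def wMat (w : V → V → ℝ) : Matrix V V ℝ :=
  Matrix.of fun v u => if v = u then 1/2 else w v u / (2 * ∑ x, w v x)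

/-- stationary distribution of the lazy random walk on the network with edge weights `w` -/
def wSta (w : V → V → ℝ) (v : V) : ℝ := (∑ x, w v x) / ∑ u, ∑ x, w u x

/-- `w` is a valid system of edge weights on the graph `G`: symmetric, positive on edges
and vanishing off the edges. -/
def GoodWeights (G : SimpleGraph V) (w : V → V → ℝ) : Prop :=
  (∀ u v, w u v = w v u) ∧ (∀ u v, G.Adj u v → 0 < w u v) ∧ ∀ u v, ¬ G.Adj u v → w u v = 0

/-- the `ε` total-variation mixing time of the lazy random walk on the weighted network -/
def tmixW (w : V → V → ℝ) (ε : ℝ) : ℕ := mixTime (wMat w) (wSta w) ε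

/-- the probability of a discrete trajectory -/
def pathProb (P : Matrix V V ℝ) {k : ℕ} (w : Fin (k+1) → V) : ℝ :=
  ∏ i : Fin k, P (w i.castSucc) (w i.succ)

/-- `P_x[T_y = k]`: probability that the chain started at `x` first hits `y` at time `k` -/
def firstHit (P : Matrix V V ℝ) (x y : V) (k : ℕ) : ℝ :=
  ∑ w : Fin (k+1) → V,
    if w 0 = x ∧ w (Fin.last k) = y ∧ ∀ i : Fin k, w i.castSucc ≠ y then pathProb P w else 0

/-- the restriction of `P - I` to the complement of `y` -/
def restrQ (P : Matrix V V ℝ) (y : V) : Matrix {w : V // w ≠ y} {w : V // w ≠ y} ℝ :=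
  Matrix.of fun a b => P a.1 b.1 - if a = b then 1 else 0

/-- `exp (t A)` where `A` is the restriction of `P - I` to the complement of `y` -/
def heatRestr (P : Matrix V V ℝ) (y : V) (t : ℝ) :
    Matrix {w : V // w ≠ y} {w : V // w ≠ y} ℝ :=
  ∑' k : ℕ, (t ^ k / (Nat.factorial k : ℝ)) • (restrQ P y ^ k)

/-- `P_x[T_B < r]` for the chain `P`: the probability that the set `B` is hit before time `r` -/
def hitByTime (P : Matrix V V ℝ) (B : Finset V) (x : V) (r : ℕ) : ℝ :=
  ∑ k ∈ Finset.range r, ∑ w : Fin (k+1) → V,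
    if w 0 = x ∧ w (Fin.last k) ∈ B ∧ ∀ i : Fin k, w i.castSucc ∉ B then pathProb P w else 0


/-- the set of directed edges of `G` -/
def dirEdges (G : SimpleGraph V) : Type := {e : V × V // G.Adj e.1 e.2}

noncomputable instance (G : SimpleGraph V) : Fintype (dirEdges G) :=
  Fintype.ofFinite {e : V × V // G.Adj e.1 e.2}

instance (G : SimpleGraph V) : DecidableEq (dirEdges G) := fun a b =>
  decidable_of_iff (a.1 = b.1) Subtype.ext_iff.symm

open Classical in
/-- transition matrix of the lazy non-backtracking random walk on `G`: from `(u,v)` stay put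
with probability `1/2`, otherwise move to `(v,w)` with `w` uniform among the neighbors of `v`
other than `u`. -/
def nbrwMat (G : SimpleGraph V) : Matrix (dirEdges G) (dirEdges G) ℝ :=
  Matrix.of fun e e' =>
    if e' = e then 1/2
    else if e'.1.1 = e.1.2 ∧ e'.1.2 ≠ e.1.1 then 1 / (2 * ((deg G e.1.2 : ℝ) - 1))
    else 0

/-- the uniform distribution on directed edges, stationary for the lazy NBRW -/
def nbrwSta (G : SimpleGraph V) : dirEdges G → ℝ :=
  fun _ => 1 / (Nat.card (dirEdges G) : ℝ)

/-- The vector `v` dominates a mixture, of total mass at least `a`, of the laws at times `r < T`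
of the chain started from `ν`. -/
def DominatesMix (P : Matrix V V ℝ) (ν : V → ℝ) (T : ℕ) (a : ℝ) (v : V → ℝ) : Prop :=
  ∃ p : ℕ → ℝ, (∀ r, 0 ≤ p r) ∧ a ≤ ∑ r ∈ range T, p r ∧
    ∀ y, ∑ r ∈ range T, p r * Matrix.vecMul ν (P ^ r) y ≤ v y

lemma DominatesMix.base (P : Matrix V V ℝ) (ν : V → ℝ) {T r : ℕ} (hr : r < T) :
    DominatesMix P ν T 1 (Matrix.vecMul ν (P ^ r)) := by
  refine ⟨fun s => if s = r then 1 else 0, fun s => by positivity, ?_, fun y => ?_⟩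
  · simp [hr]
  · simp [hr]

lemma DominatesMix.comb {P : Matrix V V ℝ} {ν : V → ℝ} {T : ℕ} {a a' : ℝ} {ι : Type}
    {s : Finset ι} {c : ι → ℝ} {v : ι → V → ℝ} {w : V → ℝ} (hc : ∀ i ∈ s, 0 ≤ c i)
    (hv : ∀ i ∈ s, DominatesMix P ν T a (v i)) (hw : ∀ y, ∑ i ∈ s, c i * v i y ≤ w y)
    (ha : a' ≤ ∑ i ∈ s, c i * a) : DominatesMix P ν T a' w := by
  classical
  have : ∀ i, ∃ p : ℕ → ℝ, i ∈ s → (∀ r, 0 ≤ p r) ∧ a ≤ ∑ r ∈ range T, p r ∧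
    ∀ y, ∑ r ∈ range T, p r * Matrix.vecMul ν (P ^ r) y ≤ v i y := by
    intro i
    by_cases hi : i ∈ s
    · obtain ⟨p, hp⟩ := hv i hi
      exact ⟨p, fun _ => hp⟩
    · exact ⟨0, fun h => absurd h hi⟩
  choose p hp using this
  refine ⟨fun r => ∑ i ∈ s, c i * p i r, fun r => ?_, ?_, fun y => ?_⟩
  · exact sum_nonneg fun i hi => mul_nonneg (hc i hi) ((hp i hi).1 r)
  · rw [sum_comm]
    refine ha.trans (sum_le_sum fun i hi => ?_)
    rw [← mul_sum]
    exact mul_le_mul_of_nonneg_left (hp i hi).2.1 (hc i hi)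
  · refine le_trans ?_ (hw y)
    simp_rw [sum_mul]
    rw [sum_comm]
    refine sum_le_sum fun i hi => ?_
    simp_rw [mul_assoc]
    rw [← mul_sum]
    exact mul_le_mul_of_nonneg_left ((hp i hi).2.2 y) (hc i hi)

lemma IsStoch.pow {P : Matrix V V ℝ} (hP : IsStoch P) (t : ℕ) : IsStoch (P ^ t) := by
  induction t with
  | zero =>
    refine ⟨fun i j => ?_, fun i => ?_⟩
    · rw [pow_zero, Matrix.one_apply]; positivity
    · simp [Matrix.one_apply]
  | succ t ih =>
    refine ⟨fun i j => ?_, fun i => ?_⟩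
    · rw [pow_succ, Matrix.mul_apply]
      exact sum_nonneg fun z _ => mul_nonneg (ih.1 _ _) (hP.1 _ _)
    · simp_rw [pow_succ, Matrix.mul_apply]
      rw [sum_comm]
      simp_rw [← mul_sum, hP.2, mul_one, ih.2]

lemma DominatesMix.vecMul {P : Matrix V V ℝ} (hP : IsStoch P) {ν : V → ℝ} {T T' : ℕ} {a : ℝ}
    {v : V → ℝ} (h : DominatesMix P ν T a v) (s : ℕ) (hT : T + s ≤ T') :
    DominatesMix P ν T' a (Matrix.vecMul v (P ^ s)) := by
  obtain ⟨p, hp0, hpa, hpv⟩ := h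
  refine DominatesMix.comb (s := range T) (c := p)
    (v := fun r => Matrix.vecMul ν (P ^ (r + s))) (a := 1) (fun i _ => hp0 i)
    (fun i hi => DominatesMix.base P ν ?_) (fun y => ?_) (by simpa using hpa)
  · have := mem_range.1 hi
    omega
  · have : ∀ r, Matrix.vecMul ν (P ^ (r + s)) y =
        ∑ z, Matrix.vecMul ν (P ^ r) z * (P ^ s) z y := by
      intro r
      rw [pow_add, ← Matrix.vecMul_vecMul]
      rfl
    simp_rw [this, mul_sum]
    rw [sum_comm]
    change _ ≤ ∑ z, v z * (P ^ s) z y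
    refine sum_le_sum fun z _ => ?_
    simp_rw [← mul_assoc]
    rw [← sum_mul]
    exact mul_le_mul_of_nonneg_right (hpv z) ((hP.pow s).1 _ _)

/-- The probability that the chain started at `x` enters `F` for the first time at time `s`,
at the state `y`. -/
def hitKer (P : Matrix V V ℝ) (F : Finset V) : ℕ → V → V → ℝ
  | 0, x, y => if x ∈ F ∧ x = y then 1 else 0
  | s + 1, x, y => if x ∈ F then 0 else ∑ z, P x z * hitKer P F s z y

lemma hitKer_nonneg {P : Matrix V V ℝ} (hP : IsStoch P) (F : Finset V) (s : ℕ) (x y : V) :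
    0 ≤ hitKer P F s x y := by
  induction s generalizing x with
  | zero => simp only [hitKer]; positivity
  | succ s ih =>
    simp only [hitKer]
    split_ifs
    · rfl
    · exact sum_nonneg fun z _ => mul_nonneg (hP.1 _ _) (ih z)

lemma hitKer_eq_zero (P : Matrix V V ℝ) {F : Finset V} (s : ℕ) (x : V) {y : V} (hy : y ∉ F) :
    hitKer P F s x y = 0 := by
  induction s generalizing x with
  | zero =>
    simp only [hitKer]
    rw [if_neg]
    rintro ⟨h, rfl⟩
    exact hy h
  | succ s ih => simp [hitKer, ih]

lemma sum_hitKer_mul_le {P : Matrix V V ℝ} (hP : IsStoch P) (F : Finset V) (t : ℕ) (x y : V) :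
    ∑ s ∈ range (t + 1), ∑ z, hitKer P F s x z * (P ^ (t - s)) z y ≤ (P ^ t) x y := by
  induction t generalizing x with
  | zero =>
    by_cases hx : x ∈ F
    · simp [hitKer, hx]
    · simpa [hitKer, hx] using (hP.pow 0).1 x y
  | succ t ih =>
    rw [sum_range_succ']
    by_cases hx : x ∈ F
    · simp [hitKer, hx]
    · have h0 : ∑ z, hitKer P F 0 x z * (P ^ (t + 1 - 0)) z y = 0 := by simp [hitKer, hx]
      rw [h0, add_zero, pow_succ', Matrix.mul_apply]
      have : ∀ s ∈ range (t + 1), ∑ z, hitKer P F (s + 1) x z * (P ^ (t + 1 - (s + 1))) z y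
          = ∑ u, P x u * ∑ z, hitKer P F s u z * (P ^ (t - s)) z y := by
        intro s _
        simp only [hitKer, hx, if_false, Nat.add_sub_add_right, sum_mul, mul_sum]
        rw [sum_comm]
        simp_rw [mul_assoc]
      rw [sum_congr rfl this, sum_comm]
      simp_rw [← mul_sum]
      exact sum_le_sum fun u _ => mul_le_mul_of_nonneg_left (ih u) (hP.1 _ _)

lemma sum_hitKer_of_mem (P : Matrix V V ℝ) {F : Finset V} {x : V} (hx : x ∈ F) (n : ℕ) :
    ∑ s ∈ range (n + 1), ∑ z, hitKer P F s x z = 1 := by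
  rw [sum_range_succ']
  simp [hitKer, hx]

lemma sum_hitKer_of_notMem (P : Matrix V V ℝ) {F : Finset V} {x : V} (hx : x ∉ F) (n : ℕ) :
    ∑ s ∈ range (n + 1), ∑ z, hitKer P F s x z =
      ∑ u, P x u * ∑ s ∈ range n, ∑ z, hitKer P F s u z := by
  rw [sum_range_succ']
  simp only [hitKer, hx, false_and, if_false, sum_const_zero, add_zero, mul_sum]
  symm
  rw [sum_comm]
  exact sum_congr rfl fun s _ => sum_comm

/-- If `f ≥ 0` decreases by one in expectation outside of `F`, then `F` is hit within time `n`
with probability at least `1 - f / n`. -/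
lemma one_sub_le_sum_hitKer {P : Matrix V V ℝ} (hP : IsStoch P) (F : Finset V) {f : V → ℝ}
    (hf : ∀ x, 0 ≤ f x) (hdrift : ∀ x ∉ F, ∑ z, P x z * f z ≤ f x - 1) {B : ℝ}
    (hB : ∀ x, f x ≤ B) {n : ℕ} (hn : 0 < n) (x : V) :
    1 - B / n ≤ ∑ s ∈ range n, ∑ z, hitKer P F s x z := by
  have key : ∀ m x, ∑ i ∈ range m, (1 - ∑ s ∈ range (i + 1), ∑ z, hitKer P F s x z) ≤ f x := by
    intro m
    induction m with
    | zero => intro x; simpa using hf x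
    | succ m ih =>
      intro x
      by_cases hx : x ∈ F
      · simp only [sum_hitKer_of_mem P hx]
        simpa using hf x
      · have h1 : ∀ i ∈ range (m + 1), (1 - ∑ s ∈ range (i + 1), ∑ z, hitKer P F s x z)
            = ∑ u, P x u * (1 - ∑ s ∈ range i, ∑ z, hitKer P F s u z) := by
          intro i _
          rw [sum_hitKer_of_notMem P hx]
          simp only [mul_sub, sum_sub_distrib, mul_one, hP.2]
        rw [sum_congr rfl h1, sum_comm]
        simp_rw [← mul_sum]
        have h2 : ∑ u, P x u * ∑ i ∈ range (m + 1),
              (1 - ∑ s ∈ range i, ∑ z, hitKer P F s u z)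
            ≤ ∑ u, P x u * (f u + 1) := by
          refine sum_le_sum fun u _ => mul_le_mul_of_nonneg_left ?_ (hP.1 _ _)
          rw [sum_range_succ']
          simpa using ih u
        refine h2.trans ?_
        simp only [mul_add, sum_add_distrib, mul_one, hP.2]
        linarith [hdrift x hx]
  have hmono : ∀ i ∈ range n, 1 - ∑ s ∈ range n, ∑ z, hitKer P F s x z ≤
      1 - ∑ s ∈ range (i + 1), ∑ z, hitKer P F s x z := by
    intro i hi
    have hi' := mem_range.1 hi
    refine sub_le_sub_left (sum_le_sum_of_subset_of_nonneg ?_ fun s _ _ =>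
      sum_nonneg fun z _ => hitKer_nonneg hP F s x z) _
    intro s hs
    rw [mem_range] at hs ⊢
    omega
  have h := (sum_le_sum hmono).trans ((key n x).trans (hB x))
  rw [sum_const, card_range, nsmul_eq_mul] at h
  have hn' : (0 : ℝ) < n := by exact_mod_cast hn
  have h3 : 1 - ∑ s ∈ range n, ∑ z, hitKer P F s x z ≤ B / n := by
    rw [le_div_iff₀ hn']
    linarith
  linarith

/-- Domination of mixtures passes to every state from which the set `C` is hit quickly. -/
lemma DominatesMix.of_hit {P : Matrix V V ℝ} (hP : IsStoch P) {ν : V → ℝ} {C : Finset V}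
    {T m : ℕ} {a b : ℝ} (ha : 0 ≤ a)
    (hC : ∀ c ∈ C, DominatesMix P ν T a ((P ^ m) c)) {n : ℕ} {x : V}
    (hx : b ≤ ∑ s ∈ range n, ∑ z, hitKer P C s x z) :
    DominatesMix P ν (T + n) (b * a) ((P ^ (n + m)) x) := by
  refine DominatesMix.comb (s := range n ×ˢ C) (c := fun i => hitKer P C i.1 x i.2)
    (v := fun i => Matrix.vecMul ((P ^ m) i.2) (P ^ (n - i.1))) (a := a)
    (fun i _ => hitKer_nonneg hP _ _ _ _) (fun i hi => ?_) (fun y => ?_) ?_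
  · rw [mem_product] at hi
    exact (hC _ hi.2).vecMul hP _ (by omega)
  · refine le_trans ?_ (sum_hitKer_mul_le hP C (n + m) x y)
    rw [sum_product]
    have h1 : ∀ s ∈ range n, ∑ z ∈ C, hitKer P C s x z *
        Matrix.vecMul ((P ^ m) z) (P ^ (n - s)) y
        ≤ ∑ z, hitKer P C s x z * (P ^ (n + m - s)) z y := by
      intro s hs
      have hs' := mem_range.1 hs
      have : ∀ z, Matrix.vecMul ((P ^ m) z) (P ^ (n - s)) y = (P ^ (n + m - s)) z y := by
        intro z
        rw [show n + m - s = m + (n - s) by omega, pow_add]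
        rfl
      simp_rw [this]
      exact sum_le_sum_of_subset_of_nonneg (subset_univ _) fun z _ _ =>
        mul_nonneg (hitKer_nonneg hP _ _ _ _) ((hP.pow _).1 _ _)
    refine (sum_le_sum h1).trans (sum_le_sum_of_subset_of_nonneg ?_ fun s _ _ =>
      sum_nonneg fun z _ => mul_nonneg (hitKer_nonneg hP _ _ _ _) ((hP.pow _).1 _ _))
    intro s hs
    rw [mem_range] at hs ⊢
    omega
  · rw [← sum_mul, sum_product]
    refine mul_le_mul_of_nonneg_right (hx.trans (le_of_eq ?_)) ha
    refine sum_congr rfl fun s _ => (sum_subset (subset_univ _) fun z _ hz => ?_).symm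
    exact hitKer_eq_zero P s x hz

/-- The law `π` conditioned on `F`. -/
def condLaw (π : V → ℝ) (F : Finset V) (y : V) : ℝ := if y ∈ F then π y / ∑ z ∈ F, π z else 0

lemma DominatesMix.of_hit_uniform {P : Matrix V V ℝ} (hP : IsStoch P) {π : V → ℝ}
    {F : Finset V} (hF : 0 < ∑ z ∈ F, π z) {n : ℕ} {x : V} {b : ℝ}
    (hsymm : ∀ s, ∀ y ∈ F, ∀ z ∈ F, hitKer P F s x y = hitKer P F s x z)
    (hπ : ∀ y ∈ F, ∀ z ∈ F, π y = π z)
    (hx : b ≤ ∑ s ∈ range n, ∑ z, hitKer P F s x z) :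
    DominatesMix P (condLaw π F) (n + 1) b ((P ^ n) x) := by
  have hlaw : ∀ s z, (∑ u, hitKer P F s x u) * condLaw π F z = hitKer P F s x z := by
    intro s z
    by_cases hz : z ∈ F
    · have h1 : ∑ u, hitKer P F s x u = F.card * hitKer P F s x z := by
        rw [← sum_subset (subset_univ F) fun u _ hu => hitKer_eq_zero P s x hu,
          sum_congr rfl fun u hu => hsymm s u hu z hz, sum_const, nsmul_eq_mul]
      have h2 : ∑ u ∈ F, π u = F.card * π z := by
        rw [sum_congr rfl fun u hu => hπ u hu z hz, sum_const, nsmul_eq_mul]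
      rw [condLaw, if_pos hz, h1]
      rw [h2] at hF ⊢
      have hc : (F.card : ℝ) ≠ 0 := fun h => by simp [h] at hF
      have hp : π z ≠ 0 := fun h => by simp [h] at hF
      field_simp
    · simp [condLaw, hz, hitKer_eq_zero P s x hz]
  refine DominatesMix.comb (s := range n) (c := fun s => ∑ z, hitKer P F s x z)
    (v := fun s => Matrix.vecMul (condLaw π F) (P ^ (n - s))) (a := 1)
    (fun s _ => sum_nonneg fun z _ => hitKer_nonneg hP _ _ _ _)
    (fun s hs => DominatesMix.base _ _ (by omega)) (fun y => ?_) (by simpa using hx)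
  refine le_trans ?_ (sum_hitKer_mul_le hP F n x y)
  have h1 : ∀ s ∈ range n, (∑ z, hitKer P F s x z) *
      Matrix.vecMul (condLaw π F) (P ^ (n - s)) y
      = ∑ z, hitKer P F s x z * (P ^ (n - s)) z y := by
    intro s _
    change _ * ∑ z, _ = _
    rw [mul_sum]
    refine sum_congr rfl fun z _ => ?_
    rw [← mul_assoc, hlaw]
  rw [sum_congr rfl h1]
  refine sum_le_sum_of_subset_of_nonneg ?_ fun s _ _ =>
      sum_nonneg fun z _ => mul_nonneg (hitKer_nonneg hP _ _ _ _) ((hP.pow _).1 _ _)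
  intro s hs
  rw [mem_range] at hs ⊢
  omega

/-- First hitting laws are invariant under automorphisms of the chain. -/
lemma hitKer_equiv {P : Matrix V V ℝ} {F : Finset V} (e : V ≃ V)
    (hP : ∀ x y, P (e x) (e y) = P x y) (hF : ∀ x, e x ∈ F ↔ x ∈ F) (s : ℕ) (x y : V) :
    hitKer P F s (e x) (e y) = hitKer P F s x y := by
  induction s generalizing x with
  | zero => simp [hitKer, hF]
  | succ s ih =>
    simp only [hitKer, hF]
    split_ifs
    · rfl
    · rw [← e.sum_comp]
      simp only [hP, ih]

lemma Rev.pow {P : Matrix V V ℝ} {π : V → ℝ} (h : Rev P π) (t : ℕ) : Rev (P ^ t) π := by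
  induction t with
  | zero =>
    intro i j
    rw [pow_zero, Matrix.one_apply, Matrix.one_apply]
    by_cases hij : i = j
    · simp [hij]
    · simp [hij, Ne.symm hij]
  | succ t ih =>
    intro i j
    rw [pow_succ, Matrix.mul_apply, ← pow_succ, pow_succ', Matrix.mul_apply, mul_sum, mul_sum]
    refine sum_congr rfl fun z _ => ?_
    rw [← mul_assoc, ih i z, mul_right_comm, h z j]
    ring

/-- The weighted inner product on functions on the state space. -/
def wInner (π f g : V → ℝ) : ℝ := ∑ x, π x * (f x * g x)

lemma wInner_mulVec {P : Matrix V V ℝ} {π : V → ℝ} (h : Rev P π) (f g : V → ℝ) :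
    wInner π (P.mulVec f) g = wInner π f (P.mulVec g) := by
  simp only [wInner, Matrix.mulVec, dotProduct, sum_mul, mul_sum]
  rw [sum_comm]
  refine sum_congr rfl fun x _ => sum_congr rfl fun y _ => ?_
  linear_combination (f x * g y) * h y x

lemma sum_mul_of_rev {P : Matrix V V ℝ} (hP : IsStoch P) {π : V → ℝ} (h : Rev P π) (y : V) :
    ∑ x, π x * P x y = π y := by
  simp_rw [h _ y]
  rw [← mul_sum, hP.2, mul_one]

lemma wInner_mulVec_self_le {P : Matrix V V ℝ} (hP : IsStoch P) {π : V → ℝ} (hπ : ∀ x, 0 ≤ π x)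
    (h : Rev P π) (f : V → ℝ) : wInner π (P.mulVec f) (P.mulVec f) ≤ wInner π f f := by
  have h1 : ∀ x, P.mulVec f x * P.mulVec f x ≤ ∑ y, P x y * (f y * f y) := by
    intro x
    have h2 : 0 ≤ ∑ y, P x y * (f y - P.mulVec f x) ^ 2 :=
      sum_nonneg fun y _ => mul_nonneg (hP.1 _ _) (sq_nonneg _)
    have h3 : ∑ y, P x y * (f y - P.mulVec f x) ^ 2 =
        ∑ y, P x y * (f y * f y) - 2 * P.mulVec f x * ∑ y, P x y * f y
          + P.mulVec f x ^ 2 * ∑ y, P x y := by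
      rw [mul_sum, mul_sum, ← sum_sub_distrib, ← sum_add_distrib]
      refine sum_congr rfl fun y _ => ?_
      ring
    have h4 : ∑ y, P x y * f y = P.mulVec f x := rfl
    rw [h3, hP.2, h4] at h2
    nlinarith
  calc wInner π (P.mulVec f) (P.mulVec f) ≤ ∑ x, π x * ∑ y, P x y * (f y * f y) :=
        sum_le_sum fun x _ => mul_le_mul_of_nonneg_left (h1 x) (hπ x)
    _ = ∑ y, (∑ x, π x * P x y) * (f y * f y) := by
        simp_rw [mul_sum, sum_mul]
        rw [sum_comm]
        simp_rw [mul_assoc]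
    _ = wInner π f f := by simp_rw [sum_mul_of_rev hP h]; rfl

lemma wInner_le_half {π : V → ℝ} (hπ : ∀ x, 0 ≤ π x) (f g : V → ℝ) :
    wInner π f g ≤ (wInner π f f + wInner π g g) / 2 := by
  simp only [wInner]
  rw [← sum_add_distrib, sum_div]
  refine sum_le_sum fun x _ => ?_
  nlinarith [mul_nonneg (hπ x) (sq_nonneg (f x - g x))]

section Lazy

variable {P : Matrix V V ℝ} {π : V → ℝ}

lemma wInner_mulVec_le_self (hP : IsStoch P) (hπ : ∀ x, 0 ≤ π x) (h : Rev P π) (f : V → ℝ) :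
    wInner π f (P.mulVec f) ≤ wInner π f f := by
  have := wInner_le_half hπ f (P.mulVec f)
  have := wInner_mulVec_self_le hP hπ h f
  linarith

lemma wInner_mulVec_self_le_of_lazy (hP : IsStoch P) (hπ : ∀ x, 0 ≤ π x) (h : Rev P π)
    (hlazy : ∀ x, 1 / 2 ≤ P x x) (f : V → ℝ) :
    wInner π (P.mulVec f) (P.mulVec f) ≤ wInner π f (P.mulVec f) := by
  set Q : Matrix V V ℝ := (2 : ℝ) • P - 1 with hQ
  have hQa : ∀ x y, Q x y = 2 * P x y - if x = y then 1 else 0 := by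
    intro x y
    simp [hQ, Matrix.one_apply]
  have hQs : IsStoch Q := by
    refine ⟨fun x y => ?_, fun x => ?_⟩
    · rw [hQa]
      split_ifs with hxy
      · subst hxy
        linarith [hlazy x]
      · linarith [hP.1 x y]
    · simp_rw [hQa, sum_sub_distrib, ← mul_sum, hP.2]
      norm_num
  have hQr : Rev Q π := by
    intro x y
    rw [hQa, hQa]
    by_cases hxy : x = y
    · subst hxy
      ring
    · rw [if_neg hxy, if_neg (Ne.symm hxy)]
      linear_combination 2 * h x y
  have hQf : Q.mulVec f = fun x => 2 * P.mulVec f x - f x := by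
    funext x
    rw [hQ, Matrix.sub_mulVec, Matrix.smul_mulVec, Matrix.one_mulVec]
    simp
  have h1 := wInner_mulVec_self_le hQs hπ hQr f
  rw [hQf] at h1
  simp only [wInner] at h1 ⊢
  have h2 : ∑ x, π x * ((2 * P.mulVec f x - f x) * (2 * P.mulVec f x - f x)) =
      4 * ∑ x, π x * (P.mulVec f x * P.mulVec f x) - 4 * ∑ x, π x * (f x * P.mulVec f x)
        + ∑ x, π x * (f x * f x) := by
    rw [mul_sum, mul_sum, ← sum_sub_distrib, ← sum_add_distrib]
    refine sum_congr rfl fun x _ => ?_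
    ring
  linarith

lemma wInner_pow_mulVec (h : Rev P π) (f : V → ℝ) (s t : ℕ) :
    wInner π ((P ^ s).mulVec f) ((P ^ t).mulVec f) = wInner π f ((P ^ (s + t)).mulVec f) := by
  rw [wInner_mulVec (h.pow s), Matrix.mulVec_mulVec, ← pow_add]

lemma antitone_wInner_pow_mulVec (hP : IsStoch P) (hπ : ∀ x, 0 ≤ π x) (h : Rev P π)
    (hlazy : ∀ x, 1 / 2 ≤ P x x) (f : V → ℝ) :
    Antitone fun t => wInner π f ((P ^ t).mulVec f) := by
  refine antitone_nat_of_succ_le fun t => ?_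
  have hs : ∀ s, (P ^ (s + 1)).mulVec f = P.mulVec ((P ^ s).mulVec f) := by
    intro s
    rw [Matrix.mulVec_mulVec, ← pow_succ']
  obtain ⟨s, rfl | rfl⟩ := Nat.even_or_odd' t
  · rw [show 2 * s + 1 = s + (s + 1) by ring, ← wInner_pow_mulVec h, two_mul,
      ← wInner_pow_mulVec h, hs]
    exact wInner_mulVec_le_self hP hπ h _
  · rw [show 2 * s + 1 + 1 = (s + 1) + (s + 1) by ring, ← wInner_pow_mulVec h,
      show 2 * s + 1 = s + (s + 1) by ring, ← wInner_pow_mulVec h, hs]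
    exact wInner_mulVec_self_le_of_lazy hP hπ h hlazy _

lemma sum_abs_sub_one_le (hπ : IsProb π) {g : V → ℝ} (hg : ∑ x, π x * g x = 1)
    (hg2 : wInner π g g ≤ 20 / 19) : ∑ x, |π x * g x - π x| ≤ 6 / 25 := by
  have h1 : ∀ x, |π x * g x - π x| ≤
      2 * (π x * (g x * g x)) - 4 * (π x * g x) + (2 + 1 / 8) * π x := by
    intro x
    have hx := hπ.1 x
    rw [show π x * g x - π x = π x * (g x - 1) by ring, abs_mul, abs_of_pos hx]
    have : |g x - 1| ≤ 2 * (g x - 1) ^ 2 + 1 / 8 := by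
      rw [← sq_abs]
      nlinarith [sq_nonneg (|g x - 1| - 1 / 4)]
    nlinarith
  refine (sum_le_sum fun x _ => h1 x).trans ?_
  rw [sum_add_distrib, sum_sub_distrib, ← mul_sum, ← mul_sum, ← mul_sum, hg, hπ.2]
  have : ∑ x, π x * (g x * g x) ≤ 20 / 19 := hg2
  linarith

lemma dTV_le_of_forall [Nonempty V] {t : ℕ} {ε : ℝ} (h : ∀ x, tvDist ((P ^ t) x) π ≤ ε) :
    dTV P π t ≤ ε := ciSup_le h

/-- If from every state the chain at time `S` dominates most of a mixture of laws started from
the stationary distribution conditioned on `F`, then the chain mixes by time `2 S`. -/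
theorem mixTime_le_of_dominatesMix [Nonempty V] (hP : IsStoch P) (hπ : IsProb π) (h : Rev P π)
    (hlazy : ∀ x, 1 / 2 ≤ P x x) {F : Finset V} (hF : F.Nonempty) {S : ℕ}
    (hdom : ∀ x, DominatesMix P (condLaw π F) (S + 1) (19 / 20) ((P ^ S) x)) :
    mixTime P π (1 / 4) ≤ 2 * S := by
  have hπ0 : ∀ x, 0 ≤ π x := fun x => (hπ.1 x).le
  set pF := ∑ z ∈ F, π z with hpF
  have hpF0 : 0 < pF := sum_pos (fun z _ => hπ.1 z) hF
  set g : ℕ → V → ℝ := fun t => (P ^ t).mulVec fun z => if z ∈ F then 1 / pF else 0 with hg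
  have hlaw : ∀ t y, Matrix.vecMul (condLaw π F) (P ^ t) y = π y * g t y := by
    intro t y
    simp only [hg, Matrix.vecMul, Matrix.mulVec, dotProduct, mul_sum]
    refine sum_congr rfl fun z _ => ?_
    rw [condLaw]
    split_ifs
    · rw [← mul_assoc, ← h.pow t z y]
      ring
    · simp
  set a : ℕ → ℝ := fun t => wInner π (g 0) (g t) with ha
  have hg0 : g 0 = fun z => if z ∈ F then 1 / pF else 0 := by simp [hg]
  have haF : ∀ t, ∑ y ∈ F, π y * g t y = a t * pF := by
    intro t
    simp only [ha, wInner, hg0]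
    rw [sum_mul, ← sum_filter_add_sum_filter_not univ (· ∈ F)]
    rw [sum_eq_zero (s := univ.filter fun x => x ∉ F), add_zero, filter_mem_eq_inter, univ_inter]
    · refine sum_congr rfl fun y hy => ?_
      rw [if_pos hy]
      field_simp
    · intro x hx
      rw [mem_filter] at hx
      simp [hx.2]
  have hanti : Antitone a := by
    have := antitone_wInner_pow_mulVec hP hπ0 h hlazy (g 0)
    rw [hg0] at this
    simpa only [ha, hg0] using this
  have hg1 : ∀ t, ∑ y, π y * g t y = 1 := by
    intro t
    have h1 : ∑ y, π y * g t y = ∑ y, ∑ z, condLaw π F z * (P ^ t) z y :=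
      sum_congr rfl fun y _ => (hlaw t y).symm
    rw [h1, sum_comm]
    simp_rw [← mul_sum, (hP.pow t).2, mul_one, condLaw]
    rw [sum_ite_mem, univ_inter, ← sum_div, div_self hpF0.ne']
  have haS : a S ≤ 20 / 19 := by
    have h1 : ∀ x, 19 / 20 * (a S * pF) ≤ ∑ y ∈ F, (P ^ S) x y := by
      intro x
      obtain ⟨p, hp0, hp1, hp⟩ := hdom x
      have h2 : ∑ y ∈ F, ∑ r ∈ range (S + 1), p r * (π y * g r y) ≤ ∑ y ∈ F, (P ^ S) x y :=
        sum_le_sum fun y _ => by simpa [hlaw] using hp y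
      refine le_trans ?_ h2
      rw [sum_comm]
      simp_rw [← mul_sum, haF]
      have haS0 : 0 ≤ a S * pF := by
        rw [← haF]
        refine sum_nonneg fun y _ => mul_nonneg (hπ0 y) ?_
        refine sum_nonneg fun z _ => mul_nonneg ((hP.pow _).1 _ _) ?_
        dsimp only
        split_ifs <;> positivity
      calc 19 / 20 * (a S * pF) ≤ (∑ r ∈ range (S + 1), p r) * (a S * pF) :=
            mul_le_mul_of_nonneg_right hp1 haS0
        _ ≤ _ := by
            rw [sum_mul]
            refine sum_le_sum fun r hr => mul_le_mul_of_nonneg_left ?_ (hp0 r)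
            exact mul_le_mul_of_nonneg_right
              (hanti (Nat.lt_succ_iff.1 (mem_range.1 hr))) hpF0.le
    have h2 : ∑ x, π x * (19 / 20 * (a S * pF)) ≤ pF := by
      refine (sum_le_sum fun x _ => mul_le_mul_of_nonneg_left (h1 x) (hπ0 x)).trans ?_
      simp_rw [mul_sum]
      rw [sum_comm]
      simp_rw [sum_mul_of_rev (hP.pow S) (h.pow S)]
      exact le_rfl
    rw [← sum_mul, hπ.2, one_mul] at h2
    have h3 : 19 / 20 * a S ≤ 1 := by
      by_contra hcon
      push Not at hcon
      nlinarith
    linarith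
  have hgt : ∀ r, ∑ y, |π y * g (r + S) y - π y| ≤ 6 / 25 := by
    intro r
    refine sum_abs_sub_one_le hπ (hg1 _) ?_
    have : wInner π (g (r + S)) (g (r + S)) = a (r + S + (r + S)) := by
      rw [ha]
      simp only [hg]
      rw [wInner_pow_mulVec h]
      simp
    rw [this]
    exact (hanti (by omega)).trans haS
  refine Nat.sInf_le (dTV_le_of_forall fun x => ?_)
  obtain ⟨p, hp0, hp1, hp⟩ := hdom x
  set q : V → ℝ := fun y => ∑ r ∈ range (S + 1), p r * (π y * g (r + S) y) with hq
  set m := ∑ r ∈ range (S + 1), p r with hm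
  have hqle : ∀ y, q y ≤ (P ^ (2 * S)) x y := by
    intro y
    have h1 : ∀ r, Matrix.vecMul (condLaw π F) (P ^ (r + S)) y =
        ∑ z, Matrix.vecMul (condLaw π F) (P ^ r) z * (P ^ S) z y := by
      intro r
      rw [pow_add, ← Matrix.vecMul_vecMul]
      rfl
    simp only [hq]
    simp_rw [← hlaw, h1, mul_sum]
    rw [sum_comm, two_mul, pow_add, Matrix.mul_apply]
    refine sum_le_sum fun z _ => ?_
    simp_rw [← mul_assoc]
    rw [← sum_mul]
    exact mul_le_mul_of_nonneg_right (hp z) ((hP.pow S).1 _ _)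
  have hqsum : ∑ y, q y = m := by
    simp only [hq]
    rw [sum_comm]
    simp_rw [← mul_sum, hg1, mul_one]
    rfl
  have hm1 : m ≤ 1 := by
    rw [← hqsum, ← (hP.pow (2 * S)).2 x]
    exact sum_le_sum fun y _ => hqle y
  have hqπ : ∑ y, |q y - m * π y| ≤ 6 / 25 := by
    have h1 : ∀ y, |q y - m * π y| ≤ ∑ r ∈ range (S + 1), p r * |π y * g (r + S) y - π y| := by
      intro y
      simp only [hq, hm]
      rw [sum_mul, ← sum_sub_distrib]
      refine (abs_sum_le_sum_abs _ _).trans (sum_le_sum fun r _ => ?_)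
      rw [← mul_sub, abs_mul, abs_of_nonneg (hp0 r)]
    refine (sum_le_sum fun y _ => h1 y).trans ?_
    rw [sum_comm]
    simp_rw [← mul_sum]
    refine (sum_le_sum fun r _ => mul_le_mul_of_nonneg_left (hgt r) (hp0 r)).trans ?_
    rw [← sum_mul]
    linarith
  have hfin : ∑ y, |(P ^ (2 * S)) x y - π y| ≤ (1 - m) + 6 / 25 + (1 - m) := by
    have h1 : ∀ y, |(P ^ (2 * S)) x y - π y| ≤
        ((P ^ (2 * S)) x y - q y) + |q y - m * π y| + (1 - m) * π y := by
      intro y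
      have e : (P ^ (2 * S)) x y - π y =
        ((P ^ (2 * S)) x y - q y) + (q y - m * π y) - (1 - m) * π y := by ring
      have h2 := hqle y
      have h3 : 0 ≤ (1 - m) * π y := mul_nonneg (by linarith) (hπ0 y)
      rw [e, abs_le]
      constructor
      · linarith [neg_abs_le (q y - m * π y)]
      · linarith [le_abs_self (q y - m * π y)]
    refine (sum_le_sum fun y _ => h1 y).trans ?_
    rw [sum_add_distrib, sum_add_distrib, sum_sub_distrib, hqsum, (hP.pow _).2, ← mul_sum, hπ.2]
    linarith
  rw [tvDist]
  linarith

end Lazy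

section Convergence

variable {P : Matrix V V ℝ} {π : V → ℝ}

lemma pow_pos_of_le (hP : IsStoch P) (hdiag : ∀ x, 0 < P x x) {x y : V} {s t : ℕ} (hst : s ≤ t)
    (h : 0 < (P ^ s) x y) : 0 < (P ^ t) x y := by
  induction t, hst using Nat.le_induction with
  | base => exact h
  | succ t _ ih =>
    rw [pow_succ, Matrix.mul_apply]
    exact sum_pos' (fun z _ => mul_nonneg ((hP.pow t).1 _ _) (hP.1 _ _))
      ⟨y, mem_univ _, mul_pos ih (hdiag y)⟩

lemma exists_pow_pos (hP : IsStoch P) (hdiag : ∀ x, 0 < P x x) (hirr : Irred P) :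
    ∃ t, ∀ x y, 0 < (P ^ t) x y := by
  choose T hT using hirr
  refine ⟨univ.sup fun i : V × V => T i.1 i.2, fun x y => pow_pos_of_le hP hdiag ?_ (hT x y)⟩
  exact le_sup (f := fun i : V × V => T i.1 i.2) (mem_univ (x, y))

lemma sum_abs_vecMul_le (hP : IsStoch P) {α : ℝ} (hα : 0 ≤ α) (h : ∀ x y, α ≤ P x y)
    {v : V → ℝ} (hv : ∑ x, v x = 0) :
    ∑ y, |Matrix.vecMul v P y| ≤ (1 - α) * ∑ x, |v x| := by
  have h1 : ∀ y, |Matrix.vecMul v P y| ≤ ∑ x, |v x| * (P x y - α) := by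
    intro y
    have e : Matrix.vecMul v P y = ∑ x, v x * (P x y - α) := by
      simp_rw [mul_sub, sum_sub_distrib, ← sum_mul, hv, zero_mul, sub_zero]
      rfl
    rw [e]
    refine (abs_sum_le_sum_abs _ _).trans (sum_le_sum fun x _ => ?_)
    rw [abs_mul, abs_of_nonneg (a := P x y - α) (by linarith [h x y])]
  refine (sum_le_sum fun y _ => h1 y).trans ?_
  rw [sum_comm, mul_sum]
  refine sum_le_sum fun x _ => ?_
  rw [← mul_sum, sum_sub_distrib, hP.2, mul_comm]
  refine mul_le_mul_of_nonneg_right (sub_le_sub_left ?_ _) (abs_nonneg _)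
  exact single_le_sum (f := fun _ : V => α) (fun _ _ => hα) (mem_univ x)

lemma vecMul_pow_eq (hπP : Matrix.vecMul π P = π) (t : ℕ) : Matrix.vecMul π (P ^ t) = π := by
  induction t with
  | zero => simp
  | succ t ih => rw [pow_succ, ← Matrix.vecMul_vecMul, ih, hπP]

theorem exists_dTV_le [Nonempty V] (hP : IsStoch P) (hdiag : ∀ x, 0 < P x x) (hirr : Irred P)
    (hπ : ∑ x, π x = 1) (hπP : Matrix.vecMul π P = π) {ε : ℝ} (hε : 0 < ε) :
    ∃ t, dTV P π t ≤ ε := by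
  obtain ⟨m, hm⟩ := exists_pow_pos hP hdiag hirr
  obtain ⟨i, hi⟩ := Finite.exists_min fun i : V × V => (P ^ m) i.1 i.2
  set α := (P ^ m) i.1 i.2
  have hα : 0 < α := hm _ _
  have hα1 : α ≤ 1 := by
    rw [← (hP.pow m).2 i.1]
    exact single_le_sum (f := fun y => (P ^ m) i.1 y) (fun y _ => (hP.pow m).1 _ _) (mem_univ i.2)
  have key : ∀ x j, ∑ y, |(P ^ (m * j)) x y - π y| ≤
      (1 - α) ^ j * ∑ y, |(1 : Matrix V V ℝ) x y - π y| := by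
    intro x j
    induction j with
    | zero => simp
    | succ j ih =>
      have h0 : ∑ y, ((P ^ (m * j)) x y - π y) = 0 := by
        rw [sum_sub_distrib, (hP.pow _).2, hπ, sub_self]
      have h1 := sum_abs_vecMul_le (hP.pow m) hα.le (fun x y => hi (x, y)) h0
      have h2 : ∀ y, Matrix.vecMul (fun y => (P ^ (m * j)) x y - π y) (P ^ m) y =
          (P ^ (m * (j + 1))) x y - π y := by
        intro y
        have := congrFun (Matrix.sub_vecMul (P ^ m) ((P ^ (m * j)) x) π) y
        rw [Pi.sub_apply, vecMul_pow_eq hπP] at this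
        rw [mul_add, mul_one, pow_add]
        exact this
      simp_rw [h2] at h1
      refine h1.trans ?_
      rw [pow_succ', mul_assoc]
      exact mul_le_mul_of_nonneg_left ih (by linarith)
  obtain ⟨x0, hx0⟩ := Finite.exists_max fun x => ∑ y, |(1 : Matrix V V ℝ) x y - π y|
  set K := ∑ y, |(1 : Matrix V V ℝ) x0 y - π y|
  have hlim : Tendsto (fun j : ℕ => (1 - α) ^ j * K) atTop (nhds (0 * K)) :=
    (tendsto_pow_atTop_nhds_zero_of_lt_one (by linarith) (by linarith)).mul_const K
  rw [zero_mul] at hlim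
  obtain ⟨j, hj⟩ := (hlim.eventually (gt_mem_nhds hε)).exists
  refine ⟨m * j, ciSup_le fun x => ?_⟩
  have h1 := key x j
  have h2 : (1 - α) ^ j * ∑ y, |(1 : Matrix V V ℝ) x y - π y| ≤ (1 - α) ^ j * K :=
    mul_le_mul_of_nonneg_left (hx0 x) (pow_nonneg (by linarith) j)
  rw [tvDist]
  have h3 : 0 ≤ ∑ y, |(P ^ (m * j)) x y - π y| := sum_nonneg fun y _ => abs_nonneg _
  linarith

end Convergence

section LowerBound

variable {P : Matrix V V ℝ} {π : V → ℝ}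

lemma sum_pow_le_of_supermartingale (hP : IsStoch P) {φ : V → ℝ} {q : ℝ} (hq : 0 ≤ q)
    (hstep : ∀ x, ∑ y, P x y * φ y ≤ q * φ x) (t : ℕ) (x : V) :
    ∑ y, (P ^ t) x y * φ y ≤ q ^ t * φ x := by
  induction t with
  | zero => simp [Matrix.one_apply]
  | succ t ih =>
    have h1 : ∑ y, (P ^ (t + 1)) x y * φ y = ∑ z, (P ^ t) x z * ∑ y, P z y * φ y := by
      simp_rw [pow_succ, Matrix.mul_apply, sum_mul, mul_sum]
      rw [sum_comm]
      simp_rw [mul_assoc]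
    rw [h1]
    calc _ ≤ ∑ z, (P ^ t) x z * (q * φ z) :=
          sum_le_sum fun z _ => mul_le_mul_of_nonneg_left (hstep z) ((hP.pow t).1 _ _)
      _ = q * ∑ z, (P ^ t) x z * φ z := by
          rw [mul_sum]
          exact sum_congr rfl fun z _ => by ring
      _ ≤ q * (q ^ t * φ x) := mul_le_mul_of_nonneg_left ih hq
      _ = _ := by ring

lemma sum_sub_sum_le_tvDist {μ ν : V → ℝ} (h : ∑ x, μ x = ∑ x, ν x) (B : Finset V) :
    ∑ x ∈ B, ν x - ∑ x ∈ B, μ x ≤ tvDist μ ν := by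
  have h1 : ∑ x ∈ B, ν x - ∑ x ∈ B, μ x ≤ ∑ x ∈ B, |μ x - ν x| := by
    rw [← sum_sub_distrib]
    refine sum_le_sum fun x _ => ?_
    rw [abs_sub_comm]
    exact le_abs_self _
  have h2 : ∑ x ∈ Bᶜ, μ x - ∑ x ∈ Bᶜ, ν x ≤ ∑ x ∈ Bᶜ, |μ x - ν x| := by
    rw [← sum_sub_distrib]
    exact sum_le_sum fun x _ => le_abs_self _
  have h3 := sum_add_sum_compl B μ
  have h4 := sum_add_sum_compl B ν
  have h5 := sum_add_sum_compl B fun x => |μ x - ν x|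
  rw [tvDist]
  linarith

/-- A set of large stationary measure which is entered only slowly from some state, as
witnessed by an approximate supermartingale, bounds the mixing time from below. -/
theorem le_mixTime_of_supermartingale (hP : IsStoch P) (hπ : ∑ x, π x = 1)
    (hmix : ∃ t, dTV P π t ≤ 1 / 4) {φ : V → ℝ} {q : ℝ} (hq : 1 ≤ q) (hφ : ∀ x, 0 ≤ φ x)
    (hstep : ∀ x, ∑ y, P x y * φ y ≤ q * φ x) {B : Finset V} (hB : ∀ x ∈ B, 1 ≤ φ x)
    (hπB : 3 / 4 ≤ ∑ x ∈ B, π x) {T : ℕ} {x : V} (hT : q ^ T * φ x ≤ 1 / 4) :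
    T ≤ mixTime P π (1 / 4) := by
  refine le_csInf hmix fun t ht => ?_
  by_contra hlt
  push Not at hlt
  have h1 : ∑ y ∈ B, (P ^ t) x y ≤ 1 / 4 := by
    calc ∑ y ∈ B, (P ^ t) x y ≤ ∑ y ∈ B, (P ^ t) x y * φ y :=
          sum_le_sum fun y hy => le_mul_of_one_le_right ((hP.pow t).1 _ _) (hB y hy)
      _ ≤ ∑ y, (P ^ t) x y * φ y :=
          sum_le_sum_of_subset_of_nonneg (subset_univ _) fun y _ _ =>
            mul_nonneg ((hP.pow t).1 _ _) (hφ y)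
      _ ≤ q ^ t * φ x := sum_pow_le_of_supermartingale hP (by linarith) hstep t x
      _ ≤ q ^ T * φ x := mul_le_mul_of_nonneg_right (pow_le_pow_right₀ hq hlt.le) (hφ x)
      _ ≤ 1 / 4 := hT
  have h2 := sum_sub_sum_le_tvDist (((hP.pow t).2 x).trans hπ.symm) B
  have h3 : tvDist ((P ^ t) x) π ≤ dTV P π t :=
    le_ciSup (f := fun x => tvDist ((P ^ t) x) π) (Set.finite_range _).bddAbove x
  have h4 : dTV P π t ≤ 1 / 4 := ht
  linarith

end LowerBound

section GraphWalk

open Classical in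
/-- The sum of `f` over the neighbours of `v`. -/
def nbrSum (G : SimpleGraph V) (v : V) (f : V → ℝ) : ℝ := ∑ u, if G.Adj v u then f u else 0

variable {G : SimpleGraph V}

lemma nbrSum_const (v : V) (c : ℝ) : nbrSum G v (fun _ => c) = deg G v * c := by
  classical
  rw [nbrSum, ← sum_filter, sum_const, nsmul_eq_mul, deg, Nat.card_eq_fintype_card,
    Fintype.card_subtype]

lemma nbrSum_add (v : V) (f g : V → ℝ) :
    nbrSum G v (fun u => f u + g u) = nbrSum G v f + nbrSum G v g := by
  simp only [nbrSum, ← sum_add_distrib]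
  refine sum_congr rfl fun u _ => ?_
  split_ifs <;> simp

lemma sum_walkMat_mul (v : V) (f : V → ℝ) :
    ∑ u, walkMat G v u * f u = f v / 2 + nbrSum G v f / (2 * deg G v) := by
  classical
  have h1 : ∀ u, walkMat G v u * f u = (if v = u then f u / 2 else 0) +
      (if G.Adj v u then f u else 0) / (2 * deg G v) := by
    intro u
    simp only [walkMat, Matrix.of_apply]
    by_cases hvu : v = u
    · subst hvu
      simp
      ring
    · by_cases ha : G.Adj v u
      · simp only [hvu, ha, if_false, if_true, zero_add]
        ring
      · simp [hvu, ha]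
  simp_rw [h1, sum_add_distrib, ← sum_div]
  simp [nbrSum]

lemma isStoch_walkMat (hG : ∀ v, 0 < deg G v) : IsStoch (walkMat G) := by
  refine ⟨fun v u => ?_, fun v => ?_⟩
  · simp only [walkMat, Matrix.of_apply]
    split_ifs <;> positivity
  · have h1 := sum_walkMat_mul (G := G) v fun _ => 1
    rw [nbrSum_const] at h1
    simp only [mul_one] at h1
    rw [h1]
    have : (0 : ℝ) < deg G v := by exact_mod_cast hG v
    field_simp
    norm_num

lemma rev_walkMat (hG : ∀ v, 0 < deg G v) : Rev (walkMat G) (degSta G) := by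
  intro v u
  have h1 : (0 : ℝ) < deg G v := by exact_mod_cast hG v
  have h2 : (0 : ℝ) < deg G u := by exact_mod_cast hG u
  simp only [walkMat, Matrix.of_apply, degSta]
  by_cases hvu : v = u
  · subst hvu
    rfl
  · by_cases ha : G.Adj v u
    · simp only [hvu, Ne.symm hvu, ha, ha.symm, if_false, if_true]
      field_simp
    · simp [hvu, Ne.symm hvu, ha, fun h : G.Adj u v => ha h.symm, SimpleGraph.adj_comm G u v]

lemma isProb_degSta [Nonempty V] (hG : ∀ v, 0 < deg G v) : IsProb (degSta G) := by
  have h0 : ∀ v, (0 : ℝ) < deg G v := fun v => by exact_mod_cast hG v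
  have h1 : 0 < ∑ u, (deg G u : ℝ) := sum_pos (fun u _ => h0 u) univ_nonempty
  refine ⟨fun v => div_pos (h0 v) h1, ?_⟩
  simp only [degSta, ← sum_div]
  exact div_self h1.ne'

lemma walkMat_drift (hG : ∀ v, 0 < deg G v) {f : V → ℝ} {v : V}
    (h : nbrSum G v (fun u => f u - f v + 2) ≤ 0) : ∑ u, walkMat G v u * f u ≤ f v - 1 := by
  have h0 : (0 : ℝ) < deg G v := by exact_mod_cast hG v
  rw [sum_walkMat_mul]
  have h1 : nbrSum G v (fun u => f u - f v + 2) = nbrSum G v f - deg G v * (f v - 2) := by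
    rw [← nbrSum_const, eq_sub_iff_add_eq, ← nbrSum_add]
    simp
  rw [h1] at h
  have h2 : nbrSum G v f / (2 * deg G v) ≤ (f v - 2) / 2 := by
    rw [div_le_div_iff₀ (by positivity) (by norm_num)]
    nlinarith
  linarith

end GraphWalk

section NBWalk

variable {G : SimpleGraph V}

/-- The tail of a directed edge. -/
def eSrc (e : dirEdges G) : V := e.1.1

/-- The head of a directed edge. -/
def eDst (e : dirEdges G) : V := e.1.2

/-- The directed edge with given ends. -/
def eMk {u v : V} (h : G.Adj u v) : dirEdges G := ⟨(u, v), h⟩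

lemma adj_eSrc_eDst (e : dirEdges G) : G.Adj (eSrc e) (eDst e) := e.2

@[simp] lemma eSrc_eMk {u v : V} (h : G.Adj u v) : eSrc (eMk h) = u := rfl

@[simp] lemma eDst_eMk {u v : V} (h : G.Adj u v) : eDst (eMk h) = v := rfl

lemma dirEdges_eq_iff {e e' : dirEdges G} : e' = e ↔ eSrc e' = eSrc e ∧ eDst e' = eDst e :=
  Subtype.ext_iff.trans Prod.ext_iff

open Classical in
lemma nbrwMat_apply (e e' : dirEdges G) : nbrwMat G e e' =
    if eSrc e' = eSrc e ∧ eDst e' = eDst e then 1 / 2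
    else if eSrc e' = eDst e ∧ eDst e' ≠ eSrc e then 1 / (2 * ((deg G (eDst e) : ℝ) - 1))
    else 0 := by
  rw [nbrwMat, Matrix.of_apply]
  exact if_congr dirEdges_eq_iff rfl rfl

open Classical in
lemma sum_dirEdges (f : V → V → ℝ) :
    ∑ e : dirEdges G, f (eSrc e) (eDst e) = ∑ u, ∑ v, if G.Adj u v then f u v else 0 := by
  rw [← Fintype.sum_prod_type' fun u v => if G.Adj u v then f u v else 0, ← sum_filter]
  exact (sum_subtype (univ.filter fun e : V × V => G.Adj e.1 e.2) (by simp)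
    fun e : V × V => f e.1 e.2).symm

lemma sum_nbrwMat_mul (φ : V → V → ℝ) (e : dirEdges G) :
    ∑ e', nbrwMat G e e' * φ (eSrc e') (eDst e') = φ (eSrc e) (eDst e) / 2 +
      (nbrSum G (eDst e) (φ (eDst e)) - φ (eDst e) (eSrc e)) /
        (2 * ((deg G (eDst e) : ℝ) - 1)) := by
  classical
  have huv := adj_eSrc_eDst e
  simp_rw [nbrwMat_apply e]
  generalize eSrc e = u at *
  generalize eDst e = v at *
  refine (sum_dirEdges fun a b => (if a = u ∧ b = v then (1 / 2 : ℝ)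
    else if a = v ∧ b ≠ u then 1 / (2 * ((deg G v : ℝ) - 1)) else 0) * φ a b).trans ?_
  have h3 : ∀ a b, (if G.Adj a b then (if a = u ∧ b = v then (1 / 2 : ℝ)
    else if a = v ∧ b ≠ u then 1 / (2 * ((deg G v : ℝ) - 1)) else 0) * φ a b else 0) =
        (if a = u then if b = v then φ u v / 2 else 0 else 0) +
        (if a = v then ((if G.Adj v b then φ v b else 0) - if b = u then φ v u else 0) /
          (2 * ((deg G v : ℝ) - 1)) else 0) := by
    intro a b
    by_cases hau : a = u
    · subst hau
      by_cases hbv : b = v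
      · subst hbv
        simp only [huv, huv.ne, if_true, if_false, and_self]
        ring
      · simp [huv.ne, hbv]
    · by_cases hav : a = v
      · subst hav
        by_cases hbu : b = u
        · subst hbu
          simp [huv.symm, hau]
        · by_cases hab : G.Adj a b
          · simp only [hau, hbu, hab, if_true, if_false, false_and, true_and, ne_eq,
              not_false_eq_true]
            ring
          · simp [hau, hbu, hab]
      · simp [hau, hav]
  simp_rw [h3, sum_add_distrib]
  congr 1
  · simp
  · rw [sum_comm]
    simp [← sum_div, sum_sub_distrib, nbrSum]

lemma one_sub_deg_pos (hG : ∀ v, 2 ≤ deg G v) (v : V) : (0 : ℝ) < deg G v - 1 := by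
  have : (2 : ℝ) ≤ deg G v := by exact_mod_cast hG v
  linarith

lemma isStoch_nbrwMat (hG : ∀ v, 2 ≤ deg G v) : IsStoch (nbrwMat G) := by
  refine ⟨fun e e' => ?_, fun e => ?_⟩
  · have := one_sub_deg_pos hG (eDst e)
    rw [nbrwMat_apply]
    split_ifs <;> positivity
  · have h1 := sum_nbrwMat_mul (G := G) (fun _ _ => 1) e
    rw [nbrSum_const] at h1
    simp only [mul_one] at h1
    rw [h1]
    have := one_sub_deg_pos hG (eDst e)
    field_simp
    norm_num

/-- Reversal of a directed edge. -/
def dirEdgeRev (e : dirEdges G) : dirEdges G := eMk (adj_eSrc_eDst e).symm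

lemma nbrwMat_rev (e e' : dirEdges G) :
    nbrwMat G (dirEdgeRev e') (dirEdgeRev e) = nbrwMat G e e' := by
  have h1 : eSrc (dirEdgeRev e) = eDst e := rfl
  have h2 : eDst (dirEdgeRev e) = eSrc e := rfl
  have h3 : eSrc (dirEdgeRev e') = eDst e' := rfl
  have h4 : eDst (dirEdgeRev e') = eSrc e' := rfl
  rw [nbrwMat_apply, nbrwMat_apply]
  by_cases hc : eSrc e' = eSrc e ∧ eDst e' = eDst e
  · rw [if_pos hc, if_pos]
    rw [h1, h2, h3, h4]
    exact ⟨hc.2.symm, hc.1.symm⟩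
  · rw [if_neg hc, if_neg]
    · by_cases hd : eSrc e' = eDst e ∧ eDst e' ≠ eSrc e
      · rw [if_pos hd, if_pos, h4, hd.1]
        rw [h1, h2, h3, h4]
        exact ⟨hd.1.symm, hd.2.symm⟩
      · rw [if_neg hd, if_neg]
        rw [h1, h2, h3, h4]
        exact fun h => hd ⟨h.1.symm, h.2.symm⟩
    · rw [h1, h2, h3, h4]
      exact fun h => hc ⟨h.2.symm, h.1.symm⟩

lemma vecMul_nbrwSta (hG : ∀ v, 2 ≤ deg G v) :
    Matrix.vecMul (nbrwSta G) (nbrwMat G) = nbrwSta G := by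
  funext e'
  have h1 : ∑ e, nbrwMat G e e' = 1 := by
    simp_rw [← nbrwMat_rev _ e']
    refine Eq.trans ?_ ((isStoch_nbrwMat hG).2 (dirEdgeRev e'))
    exact Equiv.sum_comp (Equiv.mk dirEdgeRev dirEdgeRev (fun _ => rfl) (fun _ => rfl))
      fun e => nbrwMat G (dirEdgeRev e') e
  change ∑ e, nbrwSta G e * nbrwMat G e e' = _
  simp only [nbrwSta]
  rw [← mul_sum, h1, mul_one]

lemma sum_nbrwSta [Nonempty (dirEdges G)] : ∑ e, nbrwSta G e = 1 := by
  simp only [nbrwSta]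
  rw [sum_const, card_univ, nsmul_eq_mul, Nat.card_eq_fintype_card]
  have : (0 : ℝ) < Fintype.card (dirEdges G) := by exact_mod_cast Fintype.card_pos
  field_simp

/-- One non-backtracking step. -/
def NBStep (G : SimpleGraph V) (e e' : dirEdges G) : Prop := eSrc e' = eDst e ∧ eDst e' ≠ eSrc e

lemma nbrwMat_pos_of_nbStep (hG : ∀ v, 2 ≤ deg G v) {e e' : dirEdges G} (h : NBStep G e e') :
    0 < nbrwMat G e e' := by
  have := one_sub_deg_pos hG (eDst e)
  rw [nbrwMat_apply, if_pos (show eSrc e' = eDst e ∧ eDst e' ≠ eSrc e from h)]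
  split_ifs <;> positivity

lemma exists_pow_pos_of_reach (hG : ∀ v, 2 ≤ deg G v) {e e' : dirEdges G}
    (h : Relation.ReflTransGen (NBStep G) e e') : ∃ t, 0 < (nbrwMat G ^ t) e e' := by
  induction h with
  | refl => exact ⟨0, by simp⟩
  | tail _ hstep ih =>
    obtain ⟨t, ht⟩ := ih
    have hP := isStoch_nbrwMat hG
    refine ⟨t + 1, ?_⟩
    rw [pow_succ, Matrix.mul_apply]
    exact sum_pos' (fun z _ => mul_nonneg ((hP.pow t).1 _ _) (hP.1 _ _))
      ⟨_, mem_univ _, mul_pos ht (nbrwMat_pos_of_nbStep hG hstep)⟩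

lemma exists_dTV_nbrwMat_le [Nonempty (dirEdges G)] (hG : ∀ v, 2 ≤ deg G v)
    (h : ∀ e e', Relation.ReflTransGen (NBStep G) e e') :
    ∃ t, dTV (nbrwMat G) (nbrwSta G) t ≤ 1 / 4 :=
  exists_dTV_le (isStoch_nbrwMat hG) (fun e => by simp [nbrwMat_apply])
    (fun e e' => exists_pow_pos_of_reach hG (h e e')) sum_nbrwSta (vecMul_nbrwSta hG)
    (by norm_num)

lemma nbStep_rev {e e' : dirEdges G} (h : NBStep G e e') :
    NBStep G (dirEdgeRev e') (dirEdgeRev e) := ⟨h.1.symm, fun h' => h.2 h'.symm⟩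

lemma nbReach_rev {e e' : dirEdges G} (h : Relation.ReflTransGen (NBStep G) e e') :
    Relation.ReflTransGen (NBStep G) (dirEdgeRev e') (dirEdgeRev e) := by
  induction h with
  | refl => exact .refl
  | tail _ hstep ih => exact .head (nbStep_rev hstep) ih

lemma nbrwMat_step_le (hG : ∀ v, 2 ≤ deg G v) {φ : V → V → ℝ} {r : ℝ} (e : dirEdges G)
    (h : nbrSum G (eDst e) (φ (eDst e)) ≤
      φ (eDst e) (eSrc e) + ((deg G (eDst e) : ℝ) - 1) * (1 + 2 * r) * φ (eSrc e) (eDst e)) :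
    ∑ e', nbrwMat G e e' * φ (eSrc e') (eDst e') ≤ (1 + r) * φ (eSrc e) (eDst e) := by
  rw [sum_nbrwMat_mul]
  have h0 := one_sub_deg_pos hG (eDst e)
  have h1 : (nbrSum G (eDst e) (φ (eDst e)) - φ (eDst e) (eSrc e)) /
      (2 * ((deg G (eDst e) : ℝ) - 1)) ≤
      (1 + 2 * r) * φ (eSrc e) (eDst e) / 2 := by
    rw [div_le_div_iff₀ (by positivity) (by norm_num)]
    linarith
  linarith

end NBWalk

/-- Labels of the vertices of the graph: a ternary tree glued to a butterfly network (nodes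
`node t w` at level `t` with word `w`), in which some tree edges are replaced by a long path
together with a trap, i.e. a binary tree with heap-indexed vertices. The paths and traps lie above
the node `node (t + 1) w`. -/
inductive Raw : Type
  | node (t : ℕ) (w : ℕ → Fin 3) : Raw
  | path (t : ℕ) (w : ℕ → Fin 3) (i : ℕ) : Raw
  | trap (t : ℕ) (w : ℕ → Fin 3) (x : ℕ) : Raw

namespace Raw

open Function

/-- The `i`th vertex of the path above `node (t + 1) w`. -/
def pt (h t : ℕ) (w : ℕ → Fin 3) (i : ℕ) : Raw :=
  if i = 0 then node t (update w t 0) else if i = h then node (t + 1) w else path t w i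

/-- The vertex with heap index `x` of the trap above `node (t + 1) w`. -/
def tp (t : ℕ) (w : ℕ → Fin 3) (x : ℕ) : Raw := if x = 0 then node (t + 1) w else trap t w x

/-- The neighbour of `node t w` in the direction of the letter `c`. -/
def child (h t : ℕ) (w : ℕ → Fin 3) (c : Fin 3) : Raw :=
  if t < 2 * h then
    if t < h ∧ c = 2 then path t (update w t 2) 1 else node (t + 1) (update w t c)
  else node (t + 1) (update w (t - 2 * h) c)

/-- The neighbours of `node t w` in the direction of level `t + 1`. -/
def right (h t : ℕ) (w : ℕ → Fin 3) : List Raw :=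
  if t < 4 * h then [child h t w 0, child h t w 1, child h t w 2] else []

/-- The neighbours of `node t w` in the direction of level `t - 1`. -/
def left (h : ℕ) : ℕ → (ℕ → Fin 3) → List Raw
  | 0, _ => []
  | t + 1, w =>
    if t < 2 * h then
      if t < h ∧ w t = 2 then [path t w (h - 1), trap t w 1] else [node t (update w t 0)]
    else [node t (update w (t - 2 * h) 0), node t (update w (t - 2 * h) 1),
      node t (update w (t - 2 * h) 2)]

/-- The heap index of the sibling. -/
def sib (x : ℕ) : ℕ := if x % 2 = 0 then x + 1 else x - 1

/-- The list of neighbours of a vertex. -/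
def nb (h : ℕ) : Raw → List Raw
  | node t w => left h t w ++ right h t w
  | path t w i => [pt h t w (i - 1), pt h t w (i + 1)]
  | trap t w x => tp t w (x / 2) ::
      if x < h * h then [trap t w (2 * x), trap t w (2 * x + 1)] else [trap t w (sib x)]

/-- `node (t + 1) w` is the lower end of a long path. -/
def IsLong (h t : ℕ) (w : ℕ → Fin 3) : Prop := t < h ∧ w t = 2 ∧ ∀ i, t < i → w i = 0

/-- The labels which occur as vertices. -/
def Valid (h : ℕ) : Raw → Prop
  | node t w => t ≤ 4 * h ∧ ∀ i, min t (2 * h) ≤ i → w i = 0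
  | path t w i => IsLong h t w ∧ 1 ≤ i ∧ i < h
  | trap t w x => IsLong h t w ∧ 1 ≤ x ∧ x < 2 * (h * h)

variable {h : ℕ}

lemma valid_node_update {t : ℕ} {w : ℕ → Fin 3} (hw : ∀ i, min t (2 * h) ≤ i → w i = 0)
    (ht : t < 4 * h) {j : ℕ} (hj : j < min (t + 1) (2 * h)) (c : Fin 3) :
    Valid h (node (t + 1) (update w j c)) := by
  refine ⟨ht, fun i hi => ?_⟩
  rw [update_of_ne (by omega)]
  exact hw i (by omega)

lemma valid_child {t : ℕ} {w : ℕ → Fin 3} (hv : Valid h (node t w)) (ht : t < 4 * h)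
    (hh : 2 ≤ h) (c : Fin 3) : Valid h (child h t w c) := by
  obtain ⟨_, hw⟩ := hv
  rw [child]
  split_ifs with h1 h2
  · refine ⟨⟨h2.1, update_self .., fun i hi => ?_⟩, le_rfl, by omega⟩
    rw [update_of_ne (by omega)]
    exact hw i (by omega)
  · exact valid_node_update hw ht (by omega) c
  · exact valid_node_update hw ht (by omega) c

lemma IsLong.valid {t : ℕ} {w : ℕ → Fin 3} (hl : IsLong h t w) : Valid h (node (t + 1) w) :=
  ⟨by have := hl.1; omega, fun i hi => hl.2.2 i (by have := hl.1; omega)⟩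

lemma IsLong.valid_update {t : ℕ} {w : ℕ → Fin 3} (hl : IsLong h t w) :
    Valid h (node t (update w t 0)) := by
  refine ⟨by have := hl.1; omega, fun i hi => ?_⟩
  by_cases hit : i = t
  · rw [hit, update_self]
  · rw [update_of_ne hit]
    exact hl.2.2 i (by have := hl.1; omega)

lemma sib_lt {x m : ℕ} (hm : m % 2 = 0) (hx : x < m) : sib x < m := by
  rw [sib]
  split_ifs <;> omega

lemma le_sib {x m : ℕ} (hm : m % 2 = 0) (hx : m ≤ x) : m ≤ sib x := by
  rw [sib]
  split_ifs <;> omega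

lemma valid_left {t : ℕ} {w : ℕ → Fin 3} (hv : Valid h (node t w)) (hh : 2 ≤ h) {y : Raw}
    (hy : y ∈ left h t w) : Valid h y := by
  obtain ⟨ht, hw⟩ := hv
  cases t with
  | zero => simp [left] at hy
  | succ t =>
    rw [left] at hy
    split_ifs at hy with h1 h2
    · have hl : IsLong h t w := ⟨h2.1, h2.2, fun i hi => hw i (by omega)⟩
      simp only [List.mem_cons, List.not_mem_nil, or_false] at hy
      obtain rfl | rfl := hy
      · exact ⟨hl, by omega, by omega⟩
      · exact ⟨hl, le_rfl, by nlinarith⟩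
    · simp only [List.mem_cons, List.not_mem_nil, or_false] at hy
      subst hy
      refine ⟨by omega, fun i hi => ?_⟩
      by_cases hit : i = t
      · rw [hit, update_self]
      · rw [update_of_ne hit]
        exact hw i (by omega)
    · have : ∀ c, Valid h (node t (update w (t - 2 * h) c)) := by
        refine fun c => ⟨by omega, fun i hi => ?_⟩
        rw [update_of_ne (by omega)]
        exact hw i (by omega)
      simp only [List.mem_cons, List.not_mem_nil, or_false] at hy
      obtain rfl | rfl | rfl := hy <;> exact this _

lemma valid_of_mem_nb (hh : 2 ≤ h) (he : h % 2 = 0) {x y : Raw} (hx : Valid h x)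
    (hy : y ∈ nb h x) : Valid h y := by
  have hm : (2 * (h * h)) % 2 = 0 := by omega
  have hm' : (h * h) % 2 = 0 := by simp [Nat.mul_mod, he]
  cases x with
  | node t w =>
    rw [nb, List.mem_append] at hy
    obtain hy | hy := hy
    · exact valid_left hx hh hy
    · rw [right] at hy
      split_ifs at hy with ht
      · simp only [List.mem_cons, List.not_mem_nil, or_false] at hy
        obtain rfl | rfl | rfl := hy <;> exact valid_child hx ht hh _
      · simp at hy
  | path t w i =>
    obtain ⟨hl, h1, h2⟩ := hx
    simp only [nb, List.mem_cons, List.not_mem_nil, or_false, pt] at hy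
    obtain rfl | rfl := hy
    · split_ifs
      · exact hl.valid_update
      · exact hl.valid
      · exact ⟨hl, by omega, by omega⟩
    · rw [if_neg (by omega)]
      split_ifs
      · exact hl.valid
      · exact ⟨hl, by omega, by omega⟩
  | trap t w x =>
    obtain ⟨hl, h1, h2⟩ := hx
    rw [nb, List.mem_cons] at hy
    obtain rfl | hy := hy
    · rw [tp]
      split_ifs
      · exact hl.valid
      · exact ⟨hl, by omega, by omega⟩
    · split_ifs at hy with hxm
      · simp only [List.mem_cons, List.not_mem_nil, or_false] at hy
        obtain rfl | rfl := hy
        · exact ⟨hl, by omega, by omega⟩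
        · exact ⟨hl, by omega, by omega⟩
      · simp only [List.mem_cons, List.not_mem_nil, or_false] at hy
        subst hy
        have := le_sib hm' (not_lt.1 hxm)
        exact ⟨hl, by nlinarith, sib_lt hm h2⟩

lemma update_eq_update_iff {w : ℕ → Fin 3} {i : ℕ} {c d : Fin 3} :
    update w i c = update w i d ↔ c = d := (update_injective w i).eq_iff

lemma nodup_right (t : ℕ) (w : ℕ → Fin 3) : (right h t w).Nodup := by
  rw [right]
  split_ifs
  · simp only [child]
    split_ifs <;> simp_all [update_eq_update_iff]
  · simp

lemma nodup_left (t : ℕ) (w : ℕ → Fin 3) : (left h t w).Nodup := by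
  cases t with
  | zero => simp [left]
  | succ t =>
    rw [left]
    split_ifs <;> simp [update_eq_update_iff]

/-- The level of a vertex. -/
def lev : Raw → ℕ
  | node t _ => 2 * t
  | path t _ _ => 2 * t + 1
  | trap t _ _ => 2 * t + 1

lemma lev_left {t : ℕ} {w : ℕ → Fin 3} {y : Raw} (hy : y ∈ left h t w) : lev y < 2 * t := by
  cases t with
  | zero => simp [left] at hy
  | succ t =>
    rw [left] at hy
    split_ifs at hy <;> simp only [List.mem_cons, List.not_mem_nil, or_false] at hy
    · obtain rfl | rfl := hy <;> simp only [lev] <;> omega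
    · subst hy
      simp only [lev]
      omega
    · obtain rfl | rfl | rfl := hy <;> simp only [lev] <;> omega

lemma lev_right {t : ℕ} {w : ℕ → Fin 3} {y : Raw} (hy : y ∈ right h t w) : 2 * t < lev y := by
  have : ∀ c, 2 * t < lev (child h t w c) := by
    intro c
    rw [child]
    split_ifs <;> simp only [lev] <;> omega
  rw [right] at hy
  split_ifs at hy
  · simp only [List.mem_cons, List.not_mem_nil, or_false] at hy
    obtain rfl | rfl | rfl := hy <;> exact this _
  · simp at hy

lemma nodup_nb (he : h % 2 = 0) {x : Raw} (hx : Valid h x) : (nb h x).Nodup := by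
  have hm' : (h * h) % 2 = 0 := by simp [Nat.mul_mod, he]
  cases x with
  | node t w =>
    rw [nb]
    refine List.Nodup.append (nodup_left t w) (nodup_right t w) fun y hy hy' => ?_
    have := lev_left hy
    have := lev_right hy'
    omega
  | path t w i =>
    obtain ⟨hl, h1, h2⟩ := hx
    simp only [nb, List.nodup_cons, List.mem_cons, List.not_mem_nil, or_false, not_false_eq_true,
      List.nodup_nil, and_true, pt]
    split_ifs <;> simp <;> omega
  | trap t w x =>
    obtain ⟨hl, h1, h2⟩ := hx
    rw [nb]
    split_ifs with hxm
    · simp only [List.nodup_cons, List.mem_cons, List.not_mem_nil, or_false, not_false_eq_true,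
        List.nodup_nil, and_true, tp]
      split_ifs <;> simp <;> omega
    · have := le_sib hm' (not_lt.1 hxm)
      simp only [List.nodup_cons, List.mem_cons, List.not_mem_nil, or_false, not_false_eq_true,
        List.nodup_nil, and_true, tp]
      split_ifs <;> simp <;> omega

lemma notMem_nb_self (hh : 2 ≤ h) {x : Raw} (hx : Valid h x) : x ∉ nb h x := by
  cases x with
  | node t w =>
    rw [nb, List.mem_append]
    rintro (hy | hy)
    · exact lt_irrefl _ (lev_left hy)
    · exact lt_irrefl _ (lev_right hy)
  | path t w i =>
    obtain ⟨hl, h1, h2⟩ := hx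
    simp only [nb, List.mem_cons, List.not_mem_nil, or_false, pt]
    split_ifs <;> simp <;> omega
  | trap t w x =>
    obtain ⟨hl, h1, h2⟩ := hx
    rw [nb]
    simp only [List.mem_cons, tp, sib]
    split_ifs <;> simp <;> omega

lemma length_nb_le (x : Raw) : (nb h x).length ≤ 6 := by
  cases x with
  | node t w =>
    rw [nb, List.length_append]
    have h1 : (right h t w).length ≤ 3 := by rw [right]; split_ifs <;> simp
    have h2 : (left h t w).length ≤ 3 := by
      cases t with
      | zero => simp [left]
      | succ t => rw [left]; split_ifs <;> simp
    omega
  | path t w i => simp [nb]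
  | trap t w x => rw [nb]; split_ifs <;> simp

lemma two_le_length_nb (hh : 2 ≤ h) {x : Raw} (hx : Valid h x) : 2 ≤ (nb h x).length := by
  cases x with
  | node t w =>
    rw [nb, List.length_append]
    by_cases ht : t < 4 * h
    · rw [right, if_pos ht]
      simp
    · cases t with
      | zero => omega
      | succ t => rw [left, if_neg (by omega)]; simp; omega
  | path t w i => simp [nb]
  | trap t w x => rw [nb]; split_ifs <;> simp

end Raw

namespace Raw

open Function

variable {h : ℕ}

lemma mem_right_iff {t : ℕ} {w : ℕ → Fin 3} (ht : t < 4 * h) {y : Raw} :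
    y ∈ right h t w ↔ ∃ c, y = child h t w c := by
  rw [right, if_pos ht]
  simp [Fin.exists_fin_succ]

lemma mem_left_butterfly_iff {t : ℕ} {w : ℕ → Fin 3} (ht : 2 * h ≤ t) {y : Raw} :
    y ∈ left h (t + 1) w ↔ ∃ c, y = node t (update w (t - 2 * h) c) := by
  rw [left, if_neg (by omega)]
  simp [Fin.exists_fin_succ]

lemma left_long {t : ℕ} {w : ℕ → Fin 3} (ht : t < h) (hw : w t = 2) :
    left h (t + 1) w = [path t w (h - 1), trap t w 1] := by
  rw [left, if_pos (by omega), if_pos ⟨ht, hw⟩]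

lemma left_short {t : ℕ} {w : ℕ → Fin 3} (ht : t < 2 * h) (hw : ¬ (t < h ∧ w t = 2)) :
    left h (t + 1) w = [node t (update w t 0)] := by
  rw [left, if_pos ht, if_neg hw]

lemma child_long {t : ℕ} (w : ℕ → Fin 3) (ht : t < h) :
    child h t w 2 = path t (update w t 2) 1 := by
  rw [child, if_pos (by omega), if_pos ⟨ht, rfl⟩]

lemma child_short {t : ℕ} (w : ℕ → Fin 3) {c : Fin 3} (ht : t < 2 * h) (hc : ¬ (t < h ∧ c = 2)) :
    child h t w c = node (t + 1) (update w t c) := by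
  rw [child, if_pos ht, if_neg hc]

lemma child_butterfly {t : ℕ} (w : ℕ → Fin 3) (c : Fin 3) (ht : 2 * h ≤ t) :
    child h t w c = node (t + 1) (update w (t - 2 * h) c) := by
  rw [child, if_neg (by omega)]

lemma pt_zero (t : ℕ) (w : ℕ → Fin 3) : pt h t w 0 = node t (update w t 0) := if_pos rfl

lemma pt_self (hh : 2 ≤ h) (t : ℕ) (w : ℕ → Fin 3) : pt h t w h = node (t + 1) w := by
  rw [pt, if_neg (by omega), if_pos rfl]

lemma pt_of_lt {i : ℕ} (t : ℕ) (w : ℕ → Fin 3) (h1 : 1 ≤ i) (h2 : i < h) :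
    pt h t w i = path t w i := by
  rw [pt, if_neg (by omega), if_neg (by omega)]

lemma tp_zero (t : ℕ) (w : ℕ → Fin 3) : tp t w 0 = node (t + 1) w := if_pos rfl

lemma tp_of_pos {x : ℕ} (t : ℕ) (w : ℕ → Fin 3) (hx : 1 ≤ x) : tp t w x = trap t w x := by
  rw [tp, if_neg (by omega)]

lemma mem_nb_symm (hh : 2 ≤ h) (he : h % 2 = 0) {x y : Raw} (hx : Valid h x)
    (hy : y ∈ nb h x) : x ∈ nb h y := by
  have hm' : (h * h) % 2 = 0 := by simp [Nat.mul_mod, he]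
  cases x with
  | node t w =>
    obtain ⟨ht, hw⟩ := hx
    rw [nb, List.mem_append] at hy
    obtain hy | hy := hy
    · cases t with
      | zero => simp [left] at hy
      | succ t =>
        by_cases ht2 : t < 2 * h
        · by_cases hlong : t < h ∧ w t = 2
          · rw [left_long hlong.1 hlong.2] at hy
            simp only [List.mem_cons, List.not_mem_nil, or_false] at hy
            obtain rfl | rfl := hy
            · rw [nb, Nat.sub_add_cancel (by omega), pt_self hh]
              simp
            · simp [nb, tp_zero]
          · rw [left_short ht2 hlong, List.mem_singleton] at hy
            subst hy
            rw [nb, List.mem_append, mem_right_iff (by omega)]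
            refine Or.inr ⟨w t, ?_⟩
            rw [child_short _ ht2 hlong, update_idem, update_eq_self]
        · rw [mem_left_butterfly_iff (by omega)] at hy
          obtain ⟨c, rfl⟩ := hy
          rw [nb, List.mem_append, mem_right_iff (by omega)]
          refine Or.inr ⟨w (t - 2 * h), ?_⟩
          rw [child_butterfly _ _ (by omega), update_idem, update_eq_self]
    · by_cases ht4 : t < 4 * h
      · rw [mem_right_iff ht4] at hy
        obtain ⟨c, rfl⟩ := hy
        by_cases ht2 : t < 2 * h
        · have hwt : w t = 0 := hw t (by omega)
          have hup : ∀ c, update (update w t c) t 0 = w := by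
            intro c
            rw [update_idem, ← hwt, update_eq_self]
          by_cases hlong : t < h ∧ c = 2
          · obtain ⟨h1, rfl⟩ := hlong
            rw [child_long _ h1]
            simp [nb, pt_zero, hup]
          · rw [child_short _ ht2 hlong, nb, List.mem_append, left_short ht2 (by simpa using hlong),
              hup]
            simp
        · rw [child_butterfly _ _ (by omega), nb, List.mem_append,
            mem_left_butterfly_iff (by omega)]
          refine Or.inl ⟨w (t - 2 * h), ?_⟩
          rw [update_idem, update_eq_self]
      · simp [right, ht4] at hy
  | path t w i =>
    obtain ⟨hl, h1, h2⟩ := hx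
    simp only [nb, List.mem_cons, List.not_mem_nil, or_false] at hy
    obtain rfl | rfl := hy
    · by_cases hi : i = 1
      · subst hi
        have := hl.1
        rw [Nat.sub_self, pt_zero, nb, List.mem_append, mem_right_iff (by omega)]
        refine Or.inr ⟨2, ?_⟩
        rw [child_long _ hl.1, update_idem, ← hl.2.1, update_eq_self]
      · rw [pt_of_lt _ _ (by omega) (by omega), nb, Nat.sub_add_cancel h1, pt_of_lt _ _ h1 h2]
        simp
    · by_cases hi : i + 1 = h
      · rw [hi, pt_self hh, nb, left_long hl.1 hl.2.1, show h - 1 = i by omega]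
        simp
      · rw [pt_of_lt _ _ (by omega) (by omega), nb, Nat.add_sub_cancel, pt_of_lt _ _ h1 h2]
        simp
  | trap t w x =>
    obtain ⟨hl, h1, h2⟩ := hx
    rw [nb, List.mem_cons] at hy
    obtain rfl | hy := hy
    · by_cases hx1 : x = 1
      · subst hx1
        rw [show 1 / 2 = 0 by norm_num, tp_zero, nb, left_long hl.1 hl.2.1]
        simp
      · rw [tp_of_pos _ _ (by omega), nb, if_pos (by omega)]
        simp only [List.mem_cons, trap.injEq, true_and, List.not_mem_nil, or_false]
        right
        omega
    · split_ifs at hy with hxm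
      · simp only [List.mem_cons, List.not_mem_nil, or_false] at hy
        obtain rfl | rfl := hy
        · rw [nb, show 2 * x / 2 = x by omega, tp_of_pos _ _ h1]
          simp
        · rw [nb, show (2 * x + 1) / 2 = x by omega, tp_of_pos _ _ h1]
          simp
      · simp only [List.mem_cons, List.not_mem_nil, or_false] at hy
        subst hy
        have := le_sib hm' (not_lt.1 hxm)
        have h3 : sib (sib x) = x := by simp only [sib]; split_ifs <;> omega
        rw [nb, if_neg (by omega), h3]
        simp

/-- The code of a vertex with all words shortened to length `l`. -/
def code (h l : ℕ) : Raw → ℕ × (Fin l → Fin 3) × ℕ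
  | node t w => (t, fun i => w i, 0)
  | path t w i => (t, fun j => w j, i)
  | trap t w x => (t, fun j => w j, h + x)

lemma eq_of_restrict_eq {l : ℕ} {w w' : ℕ → Fin 3} (hw : ∀ i, l ≤ i → w i = 0)
    (hw' : ∀ i, l ≤ i → w' i = 0) (he : (fun i : Fin l => w i) = fun i : Fin l => w' i) :
    w = w' := by
  funext i
  by_cases hi : i < l
  · exact congrFun he ⟨i, hi⟩
  · rw [hw i (not_lt.1 hi), hw' i (not_lt.1 hi)]

/-- The words of the vertex vanish from index `l` on. -/
def ShortWord (l : ℕ) : Raw → Prop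
  | node _ w => ∀ i, l ≤ i → w i = 0
  | path _ w _ => ∀ i, l ≤ i → w i = 0
  | trap _ w _ => ∀ i, l ≤ i → w i = 0

lemma code_injOn (hh : 2 ≤ h) (l : ℕ) :
    Set.InjOn (code h l) {x | Valid h x ∧ ShortWord l x} := by
  rintro (⟨t, w⟩ | ⟨t, w, i⟩ | ⟨t, w, i⟩) ⟨hx, hxl⟩ (⟨t', w'⟩ | ⟨t', w', i'⟩ | ⟨t', w', i'⟩)
    ⟨hy, hyl⟩ he <;> simp only [code, Prod.mk.injEq] at he <;> obtain ⟨rfl, hw, hi⟩ := he <;>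
    obtain rfl := eq_of_restrict_eq hxl hyl hw <;> simp only [Valid] at hx hy <;> grind

lemma shortWord_of_valid {x : Raw} (hx : Valid h x) : ShortWord (2 * h) x := by
  rcases x with ⟨t, w⟩ | ⟨t, w, i⟩ | ⟨t, w, i⟩
  · exact fun i hi => hx.2 i (by omega)
  · exact fun i hi => hx.1.2.2 i (by have := hx.1.1; omega)
  · exact fun i hi => hx.1.2.2 i (by have := hx.1.1; omega)

/-- The finite set of possible codes. -/
def codes (h l a : ℕ) : Finset (ℕ × (Fin l → Fin 3) × ℕ) :=
  range (a + 1) ×ˢ univ ×ˢ range (h + 2 * (h * h))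

lemma card_codes (l a : ℕ) :
    #(codes h l a) = (a + 1) * (3 ^ l * (h + 2 * (h * h))) := by
  simp [codes]

lemma code_mem_codes (hh : 2 ≤ h) {x : Raw} (hx : Valid h x) {l a : ℕ} (ha : h ≤ a)
    (hl : ∀ t w, x = node t w → t ≤ a) : code h l x ∈ codes h l a := by
  simp only [codes, mem_product, mem_range, mem_univ, true_and]
  rcases x with ⟨t, w⟩ | ⟨t, w, i⟩ | ⟨t, w, i⟩
  · have := hl t w rfl
    simp only [code]
    constructor <;> nlinarith
  · obtain ⟨h1, h2, h3⟩ := hx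
    have := h1.1
    simp only [code]
    constructor <;> nlinarith
  · obtain ⟨h1, h2, h3⟩ := hx
    have := h1.1
    simp only [code]
    constructor <;> nlinarith

end Raw

namespace Raw

open Function

/-- The size parameters for which the graph is considered. -/
def GoodSize (h : ℕ) : Prop := 64 ≤ h ∧ h % 2 = 0

variable {h : ℕ} [hS : Fact (GoodSize h)]

lemma sixtyFour_le : 64 ≤ h := hS.out.1

lemma two_le : 2 ≤ h := le_trans (by norm_num) (sixtyFour_le (h := h))

lemma even_size : h % 2 = 0 := hS.out.2

variable (h) in
/-- The number of vertices. -/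
def gSize : ℕ := Nat.card {x : Raw // Valid h x}

instance : Finite {x : Raw // Valid h x} := by
  have hinj : Injective fun x : {x : Raw // Valid h x} =>
      (⟨code h (2 * h) x, code_mem_codes two_le x.2 (a := 4 * h)
        (by have := two_le (h := h); omega)
        (fun t w hx => by have := x.2; rw [hx] at this; exact this.1)⟩ :
        codes h (2 * h) (4 * h)) := by
    intro x y hxy
    exact Subtype.ext (code_injOn two_le (2 * h) ⟨x.2, shortWord_of_valid x.2⟩
      ⟨y.2, shortWord_of_valid y.2⟩ (congrArg Subtype.val hxy))
  exact Finite.of_injective _ hinj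

variable (h) in
/-- A numbering of the vertices. -/
def gEquiv : Fin (gSize h) ≃ {x : Raw // Valid h x} := (Finite.equivFin _).symm

/-- The label of a vertex. -/
def label (v : Fin (gSize h)) : Raw := (gEquiv h v).1

lemma valid_label (v : Fin (gSize h)) : Valid h (label v) := (gEquiv h v).2

/-- The vertex with a given label. -/
def vert {x : Raw} (hx : Valid h x) : Fin (gSize h) := (gEquiv h).symm ⟨x, hx⟩

@[simp] lemma label_vert {x : Raw} (hx : Valid h x) : label (vert hx) = x := by
  simp [label, vert]

lemma label_injective : Injective (label (h := h)) := fun _ _ huv =>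
  (gEquiv h).injective (Subtype.ext huv)

variable (h) in
/-- The graph on the vertices with valid labels. -/
def gGraph : SimpleGraph (Fin (gSize h)) where
  Adj u v := label v ∈ nb h (label u)
  symm := ⟨fun u _ huv => mem_nb_symm two_le even_size (valid_label u) huv⟩
  loopless := ⟨fun u => notMem_nb_self two_le (valid_label u)⟩

lemma gGraph_adj {u v : Fin (gSize h)} : (gGraph h).Adj u v ↔ label v ∈ nb h (label u) := Iff.rfl

lemma nbrSum_label (v : Fin (gSize h)) (f : Raw → ℝ) :
    nbrSum (gGraph h) v (fun u => f (label u)) = ((nb h (label v)).map f).sum := by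
  classical
  rw [← List.sum_toFinset f (nodup_nb even_size (valid_label v)), nbrSum, ← sum_filter]
  refine sum_bij (fun u _ => label u) (fun u hu => ?_) (fun _ _ _ _ huv => label_injective huv)
    (fun x hx => ?_) (fun _ _ => rfl)
  · simpa [gGraph_adj] using hu
  · rw [List.mem_toFinset] at hx
    exact ⟨vert (valid_of_mem_nb two_le even_size (valid_label v) hx),
      by simpa [gGraph_adj] using hx, label_vert _⟩

lemma deg_gGraph (v : Fin (gSize h)) : deg (gGraph h) v = (nb h (label v)).length := by
  have h1 := nbrSum_const (G := gGraph h) v 1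
  have h2 := nbrSum_label v fun _ => 1
  rw [h1] at h2
  simp only [mul_one, List.map_const', List.sum_replicate, nsmul_eq_mul] at h2
  exact_mod_cast h2

lemma two_le_deg (v : Fin (gSize h)) : 2 ≤ deg (gGraph h) v := by
  rw [deg_gGraph]
  exact two_le_length_nb two_le (valid_label v)

lemma deg_le_six (v : Fin (gSize h)) : deg (gGraph h) v ≤ 6 := by
  rw [deg_gGraph]
  exact length_nb_le _

/-- The number of vertices whose code lies in a given set of codes. -/
lemma card_le_codes (s : Finset (Fin (gSize h))) {l a : ℕ} (ha : h ≤ a)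
    (hs : ∀ v ∈ s, ShortWord l (label v) ∧ ∀ t w, label v = node t w → t ≤ a) :
    #s ≤ (a + 1) * (3 ^ l * (h + 2 * (h * h))) := by
  rw [← card_codes]
  refine card_le_card_of_injOn (fun v => code h l (label v))
    (fun v hv => code_mem_codes two_le (valid_label v) ha (hs v hv).2) ?_
  intro u hu v hv huv
  exact label_injective (code_injOn two_le l ⟨valid_label u, (hs u hu).1⟩
    ⟨valid_label v, (hs v hv).1⟩ huv)

lemma gSize_le : gSize h ≤ (4 * h + 1) * (3 ^ (2 * h) * (h + 2 * (h * h))) := by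
  have := card_le_codes (h := h) univ (l := 2 * h) (a := 4 * h) (by omega)
    (fun v _ => ⟨shortWord_of_valid (valid_label v),
      fun t w hx => by have := valid_label v; rw [hx] at this; exact this.1⟩)
  simpa using this

/-- The word given by the first `l` letters, continued by zeros. -/
def extendWord {l : ℕ} (w : Fin l → Fin 3) (i : ℕ) : Fin 3 := if hi : i < l then w ⟨i, hi⟩ else 0

lemma extendWord_injective (l : ℕ) : Injective (extendWord (l := l)) := by
  intro w w' hw
  funext i
  have := congrFun hw i
  simpa [extendWord] using this

lemma extendWord_of_le {l i : ℕ} (w : Fin l → Fin 3) (hi : l ≤ i) : extendWord w i = 0 :=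
  dif_neg (by omega)

lemma pow_le_gSize : 3 ^ (2 * h) ≤ gSize h := by
  have hv : ∀ w : Fin (2 * h) → Fin 3, Valid h (node (4 * h) (extendWord w)) := fun w =>
    ⟨le_rfl, fun i hi => extendWord_of_le w (by omega)⟩
  have h1 : Injective fun w : Fin (2 * h) → Fin 3 => vert (hv w) := by
    intro w w' hw
    have := congrArg label hw
    simp only [label_vert, node.injEq, true_and] at this
    exact extendWord_injective _ this
  simpa using Fintype.card_le_of_injective _ h1

end Raw

lemma deg_iso {G : SimpleGraph V} (e : G ≃g G) (v : V) : deg G (e v) = deg G v :=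
  (Nat.card_congr (e.toEquiv.subtypeEquiv fun _ => e.map_adj_iff.symm)).symm

lemma walkMat_iso {G : SimpleGraph V} (e : G ≃g G) (v u : V) :
    walkMat G (e v) (e u) = walkMat G v u := by
  have h1 : G.Adj (e v) (e u) ↔ G.Adj v u := e.map_adj_iff
  simp only [walkMat, Matrix.of_apply, deg_iso, e.injective.eq_iff]
  split_ifs with h2 h3 h4 h5 <;> first | rfl | exact absurd (h1.1 ‹_›) ‹_› | exact absurd (h1.2 ‹_›) ‹_›

namespace Raw

open Function

variable {h : ℕ}

/-- Permute the letters of a node in the right half of the butterfly which can be chosen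
independently of the node at level `2 * h`. -/
def twist (h : ℕ) (τ : ℕ → Equiv.Perm (Fin 3)) : Raw → Raw
  | node t w => node t fun i => if 2 * h + i + 1 ≤ t then τ i (w i) else w i
  | x => x

lemma twist_node (τ : ℕ → Equiv.Perm (Fin 3)) (t : ℕ) (w : ℕ → Fin 3) :
    twist h τ (node t w) = node t fun i => if 2 * h + i + 1 ≤ t then τ i (w i) else w i := rfl

/-- The node lies in the right half of the butterfly. -/
def IsRight (h : ℕ) (x : Raw) : Prop := ∃ t w, x = node t w ∧ 2 * h < t

lemma twist_of_not_isRight (τ : ℕ → Equiv.Perm (Fin 3)) {x : Raw} (hx : ¬ IsRight h x) :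
    twist h τ x = x := by
  rcases x with ⟨t, w⟩ | ⟨t, w, i⟩ | ⟨t, w, i⟩
  · have : t ≤ 2 * h := by
      by_contra ht
      exact hx ⟨t, w, rfl, by omega⟩
    simp only [twist, node.injEq, true_and]
    funext i
    rw [if_neg (by omega)]
  · rfl
  · rfl

lemma not_isRight_of_lev {x : Raw} (hx : lev x ≤ 4 * h) : ¬ IsRight h x := by
  rintro ⟨t, w, rfl, ht⟩
  simp only [lev] at hx
  omega

lemma valid_twist (τ : ℕ → Equiv.Perm (Fin 3)) {x : Raw} (hx : Valid h x) :
    Valid h (twist h τ x) := by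
  rcases x with ⟨t, w⟩ | ⟨t, w, i⟩ | ⟨t, w, i⟩
  · obtain ⟨ht, hw⟩ := hx
    refine ⟨ht, fun i hi => ?_⟩
    dsimp only
    rw [if_neg (by omega)]
    exact hw i hi
  · exact hx
  · exact hx

lemma twist_twist_symm (τ : ℕ → Equiv.Perm (Fin 3)) (x : Raw) :
    twist h τ (twist h (fun i => (τ i).symm) x) = x := by
  rcases x with ⟨t, w⟩ | ⟨t, w, i⟩ | ⟨t, w, i⟩
  · simp only [twist, node.injEq, true_and]
    funext i
    split_ifs <;> simp
  · rfl
  · rfl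

lemma twist_mem_nb (τ : ℕ → Equiv.Perm (Fin 3)) {x y : Raw} (hx : Valid h x) (hy : y ∈ nb h x) :
    twist h τ y ∈ nb h (twist h τ x) := by
  rcases x with ⟨t, w⟩ | ⟨t, w, i⟩ | ⟨t, w, i⟩
  · rw [nb, List.mem_append] at hy
    simp only [twist_node, nb, List.mem_append]
    obtain hy | hy := hy
    · left
      obtain _ | s := t
      · simp [left] at hy
      by_cases hs : 2 * h ≤ s
      · rw [mem_left_butterfly_iff hs] at hy ⊢
        obtain ⟨c, rfl⟩ := hy
        refine ⟨c, ?_⟩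
        simp only [twist_node, node.injEq, true_and]
        funext i
        by_cases hi : i = s - 2 * h
        · subst hi
          rw [if_neg (by omega), update_self, update_self]
        · rw [update_of_ne hi, update_of_ne hi]
          have : 2 * h + i + 1 ≤ s ↔ 2 * h + i + 1 ≤ s + 1 := by omega
          simp only [this]
      · have h1 : (fun i => if 2 * h + i + 1 ≤ s + 1 then τ i (w i) else w i) = w := by
          funext i
          rw [if_neg (by omega)]
        rw [h1, twist_of_not_isRight]
        · exact hy
        · rintro ⟨t', w', rfl, ht'⟩
          have := lev_left hy
          simp only [lev] at this
          omega
    · right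
      have ht4 : t < 4 * h := by
        by_contra ht
        simp [right, ht] at hy
      rw [mem_right_iff ht4] at hy ⊢
      obtain ⟨c, rfl⟩ := hy
      by_cases ht : 2 * h ≤ t
      · refine ⟨τ (t - 2 * h) c, ?_⟩
        rw [child_butterfly _ _ ht, child_butterfly _ _ ht]
        simp only [twist_node, node.injEq, true_and]
        funext i
        by_cases hi : i = t - 2 * h
        · subst hi
          rw [if_pos (by omega), update_self, update_self]
        · rw [update_of_ne hi, update_of_ne hi]
          have : 2 * h + i + 1 ≤ t + 1 ↔ 2 * h + i + 1 ≤ t := by omega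
          simp only [this]
      · have h1 : (fun i => if 2 * h + i + 1 ≤ t then τ i (w i) else w i) = w := by
          funext i
          rw [if_neg (by omega)]
        rw [h1, twist_of_not_isRight]
        · exact ⟨c, rfl⟩
        · rintro ⟨t', w', hx, ht'⟩
          rw [child, if_pos (by omega)] at hx
          split_ifs at hx
          simp only [node.injEq] at hx
          omega
  · change twist h τ y ∈ nb h (path t w i)
    rw [twist_of_not_isRight]
    · exact hy
    have := hx.1.1
    refine not_isRight_of_lev ?_
    simp only [nb, pt, List.mem_cons, List.not_mem_nil, or_false] at hy
    obtain rfl | rfl := hy <;> split_ifs <;> simp only [lev] <;> omega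
  · change twist h τ y ∈ nb h (trap t w i)
    rw [twist_of_not_isRight]
    · exact hy
    have := hx.1.1
    refine not_isRight_of_lev ?_
    simp only [nb, tp, List.mem_cons] at hy
    split_ifs at hy <;> simp only [List.mem_cons, List.not_mem_nil, or_false] at hy <;>
      obtain rfl | hy := hy <;> (try obtain rfl | rfl := hy) <;> simp only [lev] <;> omega

variable [hS : Fact (GoodSize h)]

variable (h) in
/-- The automorphism of the graph given by `twist`. -/
def twistIso (τ : ℕ → Equiv.Perm (Fin 3)) : gGraph h ≃g gGraph h where
  toFun v := vert (valid_twist τ (valid_label v))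
  invFun v := vert (valid_twist (fun i => (τ i).symm) (valid_label v))
  left_inv v := label_injective (by
    rw [label_vert, label_vert]
    exact twist_twist_symm (fun i => (τ i).symm) (label v))
  right_inv v := label_injective (by
    rw [label_vert, label_vert]
    exact twist_twist_symm τ (label v))
  map_rel_iff' := by
    intro u v
    simp only [Equiv.coe_fn_mk, gGraph_adj, label_vert]
    refine ⟨fun huv => ?_, twist_mem_nb τ (valid_label u)⟩
    have := twist_mem_nb (fun i => (τ i).symm) (valid_twist τ (valid_label u)) huv
    have h1 : ∀ x, twist h (fun i => (τ i).symm) (twist h τ x) = x :=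
      twist_twist_symm fun i => (τ i).symm
    rwa [h1, h1] at this

lemma label_twistIso (τ : ℕ → Equiv.Perm (Fin 3)) (v : Fin (gSize h)) :
    label (twistIso h τ v) = twist h τ (label v) := label_vert _

open Classical in
variable (h) in
/-- The vertices outside the right half of the butterfly. -/
def leftPart : Finset (Fin (gSize h)) := univ.filter fun v => ¬ IsRight h (label v)

open Classical in
variable (h) in
/-- The right boundary of the butterfly. -/
def lastLevel : Finset (Fin (gSize h)) := univ.filter fun v => ∃ w, label v = node (4 * h) w

lemma mem_leftPart {v : Fin (gSize h)} : v ∈ leftPart h ↔ ¬ IsRight h (label v) := by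
  simp [leftPart]

lemma mem_lastLevel {v : Fin (gSize h)} : v ∈ lastLevel h ↔ ∃ w, label v = node (4 * h) w := by
  simp [lastLevel]

lemma lastLevel_nonempty : (lastLevel h).Nonempty := by
  have hv : Valid h (node (4 * h) fun _ => 0) := ⟨le_rfl, fun _ _ => rfl⟩
  exact ⟨vert hv, mem_lastLevel.2 ⟨_, label_vert hv⟩⟩

lemma deg_of_mem_lastLevel {v : Fin (gSize h)} (hv : v ∈ lastLevel h) : deg (gGraph h) v = 3 := by
  have := two_le (h := h)
  obtain ⟨w, hw⟩ := mem_lastLevel.1 hv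
  obtain ⟨s, hs⟩ : ∃ s, 4 * h = s + 1 := ⟨4 * h - 1, by omega⟩
  rw [deg_gGraph, hw, nb, hs, left, if_neg (by omega), right, if_neg (by omega)]
  rfl

/-- Started from the left part, the last level is hit uniformly. -/
lemma hitKer_lastLevel {x y z : Fin (gSize h)} (hx : x ∈ leftPart h) (hy : y ∈ lastLevel h)
    (hz : z ∈ lastLevel h) (s : ℕ) :
    hitKer (walkMat (gGraph h)) (lastLevel h) s x y =
      hitKer (walkMat (gGraph h)) (lastLevel h) s x z := by
  obtain ⟨w, hw⟩ := mem_lastLevel.1 hy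
  obtain ⟨w', hw'⟩ := mem_lastLevel.1 hz
  set e := twistIso h fun i => Equiv.swap (w i) (w' i) with he
  have hex : e x = x := label_injective (by
    rw [he, label_twistIso, twist_of_not_isRight _ (mem_leftPart.1 hx)])
  have hey : e y = z := label_injective (by
    have h1 : ∀ i, 2 * h ≤ i → w i = w' i := fun i hi => by
      have h1 := valid_label y
      have h2 := valid_label z
      rw [hw] at h1
      rw [hw'] at h2
      rw [h1.2 i (by omega), h2.2 i (by omega)]
    rw [he, label_twistIso, hw, hw', twist_node, node.injEq]
    refine ⟨rfl, funext fun i => ?_⟩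
    split_ifs
    · exact Equiv.swap_apply_left _ _
    · exact h1 i (by omega))
  have := hitKer_equiv (P := walkMat (gGraph h)) (F := lastLevel h) e.toEquiv
    (fun u v => walkMat_iso e u v) (fun v => ?_) s x y
  · change hitKer _ _ s (e x) (e y) = _ at this
    rw [hex, hey] at this
    exact this.symm
  · change e v ∈ _ ↔ _
    rw [mem_lastLevel, mem_lastLevel, he, label_twistIso]
    rcases label v with ⟨t, w⟩ | ⟨t, w, i⟩ | ⟨t, w, i⟩
    · simp [twist_node]
    · simp [twist]
    · simp [twist]

end Raw

namespace Raw

open Function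

variable {h : ℕ}

/-- The weight of a node of the tree, which decays along short edges and is renewed along long
paths. -/
def renew (h : ℕ) : ℕ → (ℕ → Fin 3) → ℝ
  | 0, _ => 1
  | t + 1, w => if t < h ∧ w t = 2 then 1 else 3 / 4 * renew h t w

lemma renew_congr {t : ℕ} {w w' : ℕ → Fin 3} (hw : ∀ i < t, w i = w' i) :
    renew h t w = renew h t w' := by
  induction t with
  | zero => rfl
  | succ t ih =>
    rw [renew, renew, hw t (by omega), ih fun i hi => hw i (by omega)]

lemma renew_update (t : ℕ) (w : ℕ → Fin 3) (c : Fin 3) :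
    renew h t (update w t c) = renew h t w :=
  renew_congr fun i hi => update_of_ne (by omega) _ _

lemma renew_mem (t : ℕ) (w : ℕ → Fin 3) : 0 ≤ renew h t w ∧ renew h t w ≤ 1 := by
  induction t with
  | zero => simp [renew]
  | succ t ih =>
    rw [renew]
    split_ifs
    · simp
    · constructor <;> linarith [ih.1, ih.2]

lemma renew_add_le (j : ℕ) (w : ℕ → Fin 3) : renew h (h + j) w ≤ (3 / 4) ^ j := by
  induction j with
  | zero => simpa using (renew_mem h w).2
  | succ j ih =>
    rw [← add_assoc, renew, if_neg (by omega), pow_succ]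
    linarith

/-- The part of the potential depending on the level only. -/
def levelPot (h t : ℕ) : ℝ :=
  if 2 * h ≤ t then
    30 * h * (4 * h - t) + 2 * (2 * h * (2 * h - 1) - (t - 2 * h) * (t - 2 * h - 1))
  else 60 * h * h + 4 * h * (2 * h - 1) + 68 * h * (2 * h - t)

/-- The potential of a node. -/
def nodePot (h t : ℕ) (w : ℕ → Fin 3) : ℝ :=
  (if t < 2 * h then 64 * (h : ℝ) ^ 2 * renew h t w else 0) + levelPot h t

/-- The depth of the vertex with heap index `x`. -/
def heapDepth (x : ℕ) : ℕ := if x = 0 then 0 else Nat.log 2 x + 1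

/-- The potential of a vertex of a trap, relative to the node below it. -/
def trapPot (h s : ℕ) : ℝ := 64 * (h : ℝ) ^ 2 * (1 - (1 / 2) ^ s) - 6 * s

/-- A function which bounds the expected time to reach the last level. -/
def pot (h : ℕ) : Raw → ℝ
  | node t w => nodePot h t w
  | path t w i => ((h - i) * nodePot h t w + i * nodePot h (t + 1) w) / h + 2 * i * (h - i)
  | trap t w x => nodePot h (t + 1) w + trapPot h (heapDepth x)

lemma heapDepth_eq {x : ℕ} (hx : 1 ≤ x) : heapDepth x = heapDepth (x / 2) + 1 := by
  rw [heapDepth, if_neg (by omega), heapDepth]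
  split_ifs with h1
  · have : x = 1 := by omega
    simp [this]
  · rw [Nat.log_of_one_lt_of_le (by norm_num) (by omega : 2 ≤ x)]

lemma two_pow_heapDepth_le {x : ℕ} (hx : 1 ≤ x) : 2 ^ heapDepth x ≤ 2 * x := by
  rw [heapDepth, if_neg (by omega), pow_succ]
  have := Nat.pow_log_le_self 2 (show x ≠ 0 by omega)
  omega

lemma lt_two_pow_heapDepth (x : ℕ) : x < 2 ^ heapDepth x := by
  rw [heapDepth]
  split_ifs with h1
  · simp [h1]
  · exact Nat.lt_pow_succ_log_self (by norm_num) x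

lemma heapDepth_sib {x : ℕ} (hx : 2 ≤ x) : heapDepth (sib x) = heapDepth x := by
  have h1 : 1 ≤ sib x := by rw [sib]; split_ifs <;> omega
  rw [heapDepth_eq h1, heapDepth_eq (by omega : 1 ≤ x)]
  congr 2
  rw [sib]
  split_ifs <;> omega

lemma nodePot_update (t : ℕ) (w : ℕ → Fin 3) (c : Fin 3) :
    nodePot h t (update w t c) = nodePot h t w := by
  rw [nodePot, renew_update, nodePot]

lemma pot_pt (hh : 2 ≤ h) (t : ℕ) (w : ℕ → Fin 3) {i : ℕ} : pot h (pt h t w i) =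
    ((h - i) * nodePot h t w + i * nodePot h (t + 1) w) / h + 2 * i * (h - i) := by
  have h0 : (h : ℝ) ≠ 0 := by positivity
  rw [pt]
  split_ifs with h1 h2
  · subst h1
    simp [pot, nodePot_update, h0]
  · subst h2
    simp [pot, h0]
  · rfl

lemma pot_tp (t : ℕ) (w : ℕ → Fin 3) (x : ℕ) :
    pot h (tp t w x) = nodePot h (t + 1) w + trapPot h (heapDepth x) := by
  rw [tp]
  split_ifs with h1
  · subst h1
    simp [pot, heapDepth, trapPot]
  · rfl

variable [hS : Fact (GoodSize h)]

lemma real_sixtyFour_le : (64 : ℝ) ≤ h := by exact_mod_cast sixtyFour_le (h := h)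

lemma drift_path {t i : ℕ} {w : ℕ → Fin 3} (hx : Valid h (path t w i)) :
    ((nb h (path t w i)).map fun y => pot h y - pot h (path t w i) + 2).sum ≤ 0 := by
  obtain ⟨hl, h1, h2⟩ := hx
  have h0 := real_sixtyFour_le (h := h)
  simp only [nb, List.map_cons, List.map_nil, List.sum_cons, List.sum_nil, pot_pt two_le]
  simp only [pot]
  push_cast [h1]
  apply le_of_eq
  field_simp
  ring

lemma drift_trap {t x : ℕ} {w : ℕ → Fin 3} (hx : Valid h (trap t w x)) :
    ((nb h (trap t w x)).map fun y => pot h y - pot h (trap t w x) + 2).sum ≤ 0 := by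
  obtain ⟨hl, h1, h2⟩ := hx
  have h0 := real_sixtyFour_le (h := h)
  rw [nb]
  split_ifs with hxm
  · simp only [List.map_cons, List.map_nil, List.sum_cons, List.sum_nil, pot_tp]
    simp only [pot]
    rw [heapDepth_eq (by omega : 1 ≤ 2 * x), heapDepth_eq (by omega : 1 ≤ 2 * x + 1),
      show 2 * x / 2 = x by omega, show (2 * x + 1) / 2 = x by omega, heapDepth_eq h1]
    simp only [trapPot, pow_succ]
    push_cast
    apply le_of_eq
    ring
  · have := two_le (h := h)
    have h4 : 2 ≤ x := by nlinarith
    simp only [List.map_cons, List.map_nil, List.sum_cons, List.sum_nil, pot_tp]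
    simp only [pot, heapDepth_sib h4]
    have h3 : (2 : ℝ) ^ heapDepth x ≤ 4 * (h : ℝ) ^ 2 := by
      have h5 := two_pow_heapDepth_le h1
      have : 2 ^ heapDepth x ≤ 4 * h ^ 2 := by nlinarith
      exact_mod_cast this
    rw [heapDepth_eq h1, pow_succ] at h3
    rw [heapDepth_eq h1]
    simp only [trapPot, pow_succ]
    have h6 : 32 ≤ 64 * (h : ℝ) ^ 2 * (1 / 2) ^ heapDepth (x / 2) := by
      rw [one_div, inv_pow, ← div_eq_mul_inv, le_div_iff₀ (by positivity)]
      linarith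
    push_cast
    linarith

lemma levelPot_of_lt {t : ℕ} (ht : t < 2 * h) :
    levelPot h t = levelPot h (t + 1) + 68 * h := by
  rw [levelPot, if_neg (by omega), levelPot]
  split_ifs with h1
  · have h2 : (t : ℝ) = 2 * h - 1 := by
      have : t + 1 = 2 * h := by omega
      have : ((t + 1 : ℕ) : ℝ) = (2 * h : ℕ) := by rw [this]
      push_cast at this
      linarith
    push_cast
    rw [h2]
    ring
  · push_cast
    ring

lemma levelPot_of_le {t : ℕ} (ht : 2 * h ≤ t) :
    levelPot h t = levelPot h (t + 1) + 30 * h + 4 * (t - 2 * h) := by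
  rw [levelPot, if_pos ht, levelPot, if_pos (by omega)]
  push_cast
  ring

lemma nodePot_succ_long {t : ℕ} {w : ℕ → Fin 3} (ht : t < h) (hw : w t = 2) :
    nodePot h (t + 1) w = 64 * (h : ℝ) ^ 2 + levelPot h (t + 1) := by
  rw [nodePot, if_pos (by omega), renew, if_pos ⟨ht, hw⟩, mul_one]

lemma nodePot_succ_short {t : ℕ} {w : ℕ → Fin 3} (ht : t + 1 < 2 * h) (hw : ¬ (t < h ∧ w t = 2)) :
    nodePot h (t + 1) w = 64 * (h : ℝ) ^ 2 * (3 / 4 * renew h t w) + levelPot h (t + 1) := by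
  rw [nodePot, if_pos ht, renew, if_neg hw]

lemma nodePot_of_lt {t : ℕ} (w : ℕ → Fin 3) (ht : t < 2 * h) :
    nodePot h t w = 64 * (h : ℝ) ^ 2 * renew h t w + levelPot h (t + 1) + 68 * h := by
  rw [nodePot, if_pos ht, levelPot_of_lt ht, add_assoc]

lemma nodePot_of_le {t : ℕ} (w : ℕ → Fin 3) (ht : 2 * h ≤ t) :
    nodePot h t w = levelPot h t := by
  rw [nodePot, if_neg (by omega), zero_add]

/-- The potential of a child of a node of the tree reached along a short edge. -/
lemma pot_child_short_le {t : ℕ} (w : ℕ → Fin 3) {c : Fin 3} (ht : t < 2 * h)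
    (hc : ¬ (t < h ∧ c = 2)) : pot h (child h t w c) - nodePot h t w ≤
      - (16 * (h : ℝ) ^ 2 * renew h t w) - 68 * h := by
  rw [child_short _ ht hc, pot, nodePot_of_lt w ht]
  have := renew_mem (h := h) t w
  by_cases ht1 : t + 1 < 2 * h
  · rw [nodePot_succ_short ht1 (by simpa using hc), renew_update]
    linarith
  · rw [nodePot_of_le _ (by omega)]
    nlinarith [sq_nonneg (h : ℝ), mul_nonneg (sq_nonneg (h : ℝ)) this.1]

/-- The potential of the first vertex of a long path. -/
lemma pot_child_long_le {t : ℕ} (w : ℕ → Fin 3) (ht : t < h) :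
    pot h (child h t w 2) - nodePot h t w ≤ 66 * h - 2 - 64 * (h : ℝ) * renew h t w - 68 := by
  have h0 := real_sixtyFour_le (h := h)
  rw [child_long _ ht, pot, nodePot_update, nodePot_succ_long ht (update_self ..),
    nodePot_of_lt w (by omega)]
  apply le_of_eq
  push_cast
  field_simp
  ring

lemma sum_right_le {t : ℕ} (w : ℕ → Fin 3) (ht : t < 2 * h) :
    ((right h t w).map fun y => pot h y - nodePot h t w + 2).sum ≤
      if t < h then 66 * h - 64 - 136 * h - 32 * (h : ℝ) ^ 2 * renew h t w
      else 6 - 204 * h - 48 * (h : ℝ) ^ 2 * renew h t w := by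
  have hR := renew_mem (h := h) t w
  have h0 := real_sixtyFour_le (h := h)
  rw [right, if_pos (by omega)]
  simp only [List.map_cons, List.map_nil, List.sum_cons, List.sum_nil]
  have e0 := pot_child_short_le (h := h) w (c := 0) ht (by simp)
  have e1 := pot_child_short_le (h := h) w (c := 1) ht (by simp)
  split_ifs with h1
  · have e2 := pot_child_long_le w h1
    have : 0 ≤ h * renew h t w := mul_nonneg (by linarith) hR.1
    linarith
  · have e2 := pot_child_short_le (h := h) w (c := 2) ht (by omega)
    linarith

lemma renew_two_mul_le (w : ℕ → Fin 3) :
    64 * (h : ℝ) ^ 2 * renew h (2 * h - 1) w ≤ 1 := by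
  have key : ∀ n : ℕ, 64 * ((n : ℝ) + 64) ^ 2 * (3 / 4) ^ (n + 63) ≤ 1 := by
    intro n
    induction n with
    | zero => norm_num
    | succ n ih =>
      have h1 : (((n + 1 : ℕ) : ℝ) + 64) ^ 2 * (3 / 4) ≤ ((n : ℝ) + 64) ^ 2 := by
        push_cast
        nlinarith [(Nat.cast_nonneg n : (0 : ℝ) ≤ n)]
      refine le_trans ?_ ih
      rw [show n + 1 + 63 = n + 63 + 1 by ring, pow_succ (3 / 4 : ℝ)]
      nlinarith [mul_le_mul_of_nonneg_right h1 (by positivity : (0 : ℝ) ≤ (3 / 4) ^ (n + 63))]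
  have h64 := sixtyFour_le (h := h)
  have h1 := key (h - 64)
  rw [Nat.cast_sub h64, show h - 64 + 63 = h - 1 by omega] at h1
  push_cast at h1
  rw [sub_add_cancel] at h1
  have h2 := renew_add_le (h := h) (h - 1) w
  rw [show h + (h - 1) = 2 * h - 1 by omega] at h2
  refine le_trans ?_ h1
  gcongr

lemma drift_node {t : ℕ} {w : ℕ → Fin 3} (hx : Valid h (node t w)) (ht : t < 4 * h) :
    ((nb h (node t w)).map fun y => pot h y - pot h (node t w) + 2).sum ≤ 0 := by
  have h0 := real_sixtyFour_le (h := h)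
  have hR := renew_mem (h := h) t w
  have hR2 : 0 ≤ (h : ℝ) ^ 2 * renew h t w := mul_nonneg (sq_nonneg _) hR.1
  rw [nb, List.map_append, List.sum_append]
  change ((left h t w).map fun y => pot h y - nodePot h t w + 2).sum +
    ((right h t w).map fun y => pot h y - nodePot h t w + 2).sum ≤ 0
  by_cases ht2 : t < 2 * h
  · have hr := sum_right_le w ht2
    obtain _ | t := t
    · simp only [left, List.map_nil, List.sum_nil]
      rw [if_pos (by omega)] at hr
      linarith
    by_cases hw : t < h ∧ w t = 2
    · rw [left_long hw.1 hw.2]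
      simp only [List.map_cons, List.map_nil, List.sum_cons, List.sum_nil]
      rw [renew, if_pos hw] at hr
      have e1 : pot h (path t w (h - 1)) - nodePot h (t + 1) w ≤ 2 * h + 66 := by
        have e3 := renew_mem (h := h) t w
        rw [pot, nodePot_succ_long hw.1 hw.2, nodePot_of_lt w (by omega),
          Nat.cast_sub (by omega)]
        push_cast
        field_simp
        nlinarith [mul_nonneg (sq_nonneg (h : ℝ)) (sub_nonneg.2 e3.2)]
      have e2 : pot h (trap t w 1) - nodePot h (t + 1) w = 32 * (h : ℝ) ^ 2 - 6 := by
        simp only [pot, trapPot, heapDepth]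
        norm_num
        ring
      split_ifs at hr <;> nlinarith
    · rw [left_short (by omega) hw]
      simp only [List.map_cons, List.map_nil, List.sum_cons, List.sum_nil]
      rw [renew, if_neg hw] at hr hR2
      have e1 : pot h (node t (update w t 0)) - nodePot h (t + 1) w =
          16 * (h : ℝ) ^ 2 * renew h t w + 68 * h := by
        rw [pot, nodePot_update, nodePot_succ_short ht2 hw, nodePot_of_lt w (by omega)]
        ring
      split_ifs at hr <;> nlinarith
  · obtain _ | t := t
    · omega
    rw [right, if_pos ht]
    simp only [child_butterfly _ _ (not_lt.1 ht2), List.map_cons, List.map_nil, List.sum_cons,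
      List.sum_nil]
    have e1 : ∀ c, pot h (node (t + 1 + 1) (update w (t + 1 - 2 * h) c)) -
        nodePot h (t + 1) w = - (30 * h + 4 * ((t + 1 : ℕ) - 2 * h)) := by
      intro c
      rw [pot, nodePot_of_le _ (by omega), nodePot_of_le _ (by omega),
        levelPot_of_le (not_lt.1 ht2)]
      ring
    rw [e1, e1, e1]
    by_cases hs : 2 * h ≤ t
    · rw [left, if_neg (by omega)]
      simp only [List.map_cons, List.map_nil, List.sum_cons, List.sum_nil]
      have e2 : ∀ c, pot h (node t (update w (t - 2 * h) c)) - nodePot h (t + 1) w =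
          30 * h + 4 * (t - 2 * h) := by
        intro c
        rw [pot, nodePot_of_le _ hs, nodePot_of_le _ (by omega), levelPot_of_le hs]
        ring
      rw [e2, e2, e2]
      push_cast
      linarith
    · rw [left_short (by omega) (by omega)]
      simp only [List.map_cons, List.map_nil, List.sum_cons, List.sum_nil]
      have e3 : t = 2 * h - 1 := by omega
      have e4 := renew_two_mul_le (h := h) w
      rw [← e3] at e4
      have e5 : ((t + 1 : ℕ) : ℝ) = 2 * h := by
        have : t + 1 = 2 * h := by omega
        rw [this]
        push_cast
        ring
      rw [pot, nodePot_update, nodePot_of_lt w (by omega), nodePot_of_le _ (by omega), e5]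
      linarith

lemma drift_pot {x : Raw} (hx : Valid h x) (hF : ¬ ∃ w, x = node (4 * h) w) :
    ((nb h x).map fun y => pot h y - pot h x + 2).sum ≤ 0 := by
  rcases x with ⟨t, w⟩ | ⟨t, w, i⟩ | ⟨t, w, i⟩
  · refine drift_node hx (lt_of_le_of_ne hx.1 fun ht => hF ⟨w, by rw [ht]⟩)
  · exact drift_path hx
  · exact drift_trap hx

lemma levelPot_mem {t : ℕ} (ht : t ≤ 4 * h) :
    0 ≤ levelPot h t ∧ levelPot h t ≤ 204 * (h : ℝ) ^ 2 := by
  have h0 := real_sixtyFour_le (h := h)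
  have h1 : (t : ℝ) ≤ 4 * h := by exact_mod_cast ht
  have h2 : (0 : ℝ) ≤ t := t.cast_nonneg
  rw [levelPot]
  split_ifs with h3
  · have h4 : (2 : ℝ) * h ≤ t := by exact_mod_cast h3
    constructor <;> nlinarith [mul_nonneg (sub_nonneg.2 h1) (sub_nonneg.2 h4)]
  · have h4 : (t : ℝ) ≤ 2 * h := by
      have : t ≤ 2 * h := by omega
      exact_mod_cast this
    constructor <;> nlinarith

lemma nodePot_mem {t : ℕ} (ht : t ≤ 4 * h) (w : ℕ → Fin 3) :
    0 ≤ nodePot h t w ∧ nodePot h t w ≤ 268 * (h : ℝ) ^ 2 := by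
  have h1 := levelPot_mem ht
  have h2 := renew_mem (h := h) t w
  have h3 := sq_nonneg (h : ℝ)
  rw [nodePot]
  split_ifs
  · constructor <;> nlinarith
  · constructor <;> linarith

lemma pot_mem {x : Raw} (hx : Valid h x) : 0 ≤ pot h x ∧ pot h x ≤ 340 * (h : ℝ) ^ 2 := by
  have h0 := real_sixtyFour_le (h := h)
  rcases x with ⟨t, w⟩ | ⟨t, w, i⟩ | ⟨t, w, x⟩
  · have h1 := nodePot_mem hx.1 w
    rw [pot]
    constructor <;> nlinarith
  · have ht := hx.1.1
    have h1 := nodePot_mem (h := h) (t := t) (by omega) w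
    have h2 := nodePot_mem (h := h) (t := t + 1) (by omega) w
    have h3 : (i : ℝ) ≤ h := by exact_mod_cast hx.2.2.le
    have h4 : (0 : ℝ) ≤ i := i.cast_nonneg
    have h5 : 0 ≤ ((h - i) * nodePot h t w + i * nodePot h (t + 1) w) / h := by
      apply div_nonneg _ (by linarith)
      nlinarith
    have h6 : ((h - i) * nodePot h t w + i * nodePot h (t + 1) w) / h ≤ 268 * (h : ℝ) ^ 2 := by
      rw [div_le_iff₀ (by linarith)]
      nlinarith
    rw [pot]
    constructor <;> nlinarith
  · have ht := hx.1.1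
    have h2 := nodePot_mem (h := h) (t := t + 1) (by omega) w
    obtain ⟨hl, h1, h3⟩ := hx
    have h4 : (0 : ℝ) ≤ (1 / 2) ^ heapDepth x := by positivity
    have h5 : (1 / 2 : ℝ) ^ heapDepth x ≤ 1 / 2 := by
      rw [heapDepth_eq h1, pow_succ]
      have : (1 / 2 : ℝ) ^ heapDepth (x / 2) ≤ 1 := pow_le_one₀ (by norm_num) (by norm_num)
      linarith
    have h6 : (heapDepth x : ℝ) ≤ 4 * (h : ℝ) ^ 2 := by
      have h7 := two_pow_heapDepth_le h1
      have h8 := Nat.lt_two_pow_self (n := heapDepth x)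
      have : heapDepth x ≤ 4 * h ^ 2 := by nlinarith
      exact_mod_cast this
    have h7 : (0 : ℝ) ≤ heapDepth x := Nat.cast_nonneg _
    rw [pot, trapPot]
    constructor <;> nlinarith [sq_nonneg (h : ℝ)]

/-- A function which bounds the expected time to leave the right half of the butterfly. -/
def rightPot (h : ℕ) : Raw → ℝ
  | node t _ => if 2 * h ≤ t then 2 * (t - 2 * h) * (6 * h - t) else 0
  | _ => 0

lemma drift_rightPot {x : Raw} (hx : Valid h x) (hF : IsRight h x) :
    ((nb h x).map fun y => rightPot h y - rightPot h x + 2).sum ≤ 0 := by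
  obtain ⟨t, w, rfl, ht⟩ := hF
  obtain _ | t := t
  · omega
  have hl : ((left h (t + 1) w).map fun y => rightPot h y - rightPot h (node (t + 1) w) + 2).sum =
      - 3 * (16 * h - 4 * (t + 1)) := by
    rw [left, if_neg (by omega)]
    simp only [List.map_cons, List.map_nil, List.sum_cons, List.sum_nil, rightPot]
    rw [if_pos (by omega), if_pos (by omega)]
    push_cast
    ring
  rw [nb, List.map_append, List.sum_append, hl, right]
  split_ifs with h1
  · simp only [child_butterfly _ _ ht.le, List.map_cons, List.map_nil, List.sum_cons,
      List.sum_nil, rightPot]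
    rw [if_pos (by omega), if_pos (by omega)]
    push_cast
    apply le_of_eq
    ring
  · have h2 : t + 1 = 4 * h := le_antisymm hx.1 (not_lt.1 h1)
    have h3 : ((t : ℝ) + 1) = 4 * h := by exact_mod_cast h2
    simp only [List.map_nil, List.sum_nil]
    have := real_sixtyFour_le (h := h)
    rw [h3]
    linarith

lemma rightPot_mem {x : Raw} (hx : Valid h x) :
    0 ≤ rightPot h x ∧ rightPot h x ≤ 8 * (h : ℝ) ^ 2 := by
  rcases x with ⟨t, w⟩ | ⟨t, w, i⟩ | ⟨t, w, x⟩
  · have h1 : (t : ℝ) ≤ 4 * h := by exact_mod_cast hx.1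
    rw [rightPot]
    split_ifs with h2
    · have h4 : (2 : ℝ) * h ≤ t := by exact_mod_cast h2
      constructor <;> nlinarith
    · constructor <;> positivity
  · simp only [rightPot]
    constructor <;> positivity
  · simp only [rightPot]
    constructor <;> positivity

lemma walkMat_gGraph_drift {f : Raw → ℝ} {v : Fin (gSize h)}
    (hf : ((nb h (label v)).map fun y => f y - f (label v) + 2).sum ≤ 0) :
    ∑ u, walkMat (gGraph h) v u * f (label u) ≤ f (label v) - 1 := by
  refine walkMat_drift (f := fun u => f (label u)) (fun v => ?_) ?_
  · have := two_le_deg v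
    omega
  · rw [nbrSum_label v fun y => f y - f (label v) + 2]
    exact hf

lemma sub_le_sum_hitKer {f : Raw → ℝ} {F : Finset (Fin (gSize h))} {b : ℕ}
    (hf : ∀ x, Valid h x → 0 ≤ f x ∧ f x ≤ b * (h : ℝ) ^ 2)
    (hd : ∀ v ∉ F, ((nb h (label v)).map fun y => f y - f (label v) + 2).sum ≤ 0) (hb : 0 < b)
    (v : Fin (gSize h)) :
    39 / 40 ≤ ∑ s ∈ range (40 * b * h ^ 2), ∑ z, hitKer (walkMat (gGraph h)) F s v z := by
  have h0 := sixtyFour_le (h := h)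
  have hG : ∀ v, 0 < deg (gGraph h) v := fun v => by
    have := two_le_deg v
    omega
  have := one_sub_le_sum_hitKer (isStoch_walkMat hG) F (f := fun v => f (label v))
    (fun v => (hf _ (valid_label v)).1) (fun v hv => walkMat_gGraph_drift (hd v hv))
    (fun v => (hf _ (valid_label v)).2) (n := 40 * b * h ^ 2) (by positivity) v
  refine le_trans (le_of_eq ?_) this
  have h1 : (0 : ℝ) < h := by
    have := real_sixtyFour_le (h := h)
    linarith
  push_cast
  field_simp
  norm_num

instance : Nonempty (Fin (gSize h)) := ⟨(lastLevel_nonempty (h := h)).choose⟩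

theorem tmixG_gGraph_le : tmixG (gGraph h) (1 / 4) ≤ 28000 * h ^ 2 := by
  have h0 := sixtyFour_le (h := h)
  have hG : ∀ v, 0 < deg (gGraph h) v := fun v => by
    have := two_le_deg v
    omega
  have hP := isStoch_walkMat hG
  have hπ := isProb_degSta hG
  have hC : ∀ c ∈ leftPart h, DominatesMix (walkMat (gGraph h))
      (condLaw (degSta (gGraph h)) (lastLevel h)) (40 * 340 * h ^ 2 + 1) (39 / 40)
      ((walkMat (gGraph h) ^ (40 * 340 * h ^ 2)) c) := by
    intro c hc
    refine DominatesMix.of_hit_uniform hP (sum_pos (fun z _ => hπ.1 z) lastLevel_nonempty)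
      (fun s y hy z hz => hitKer_lastLevel hc hy hz s) (fun y hy z hz => ?_) ?_
    · rw [degSta, degSta, deg_of_mem_lastLevel hy, deg_of_mem_lastLevel hz]
    · refine sub_le_sum_hitKer (b := 340) (fun x hx => by exact_mod_cast pot_mem hx)
        (fun v hv => drift_pot (valid_label v) fun hv' => hv (mem_lastLevel.2 hv'))
        (by norm_num) c
  have hdom : ∀ v, DominatesMix (walkMat (gGraph h))
      (condLaw (degSta (gGraph h)) (lastLevel h))
      (40 * 8 * h ^ 2 + 40 * 340 * h ^ 2 + 1) (19 / 20)
      ((walkMat (gGraph h) ^ (40 * 8 * h ^ 2 + 40 * 340 * h ^ 2)) v) := by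
    intro v
    have := DominatesMix.of_hit hP (by norm_num) hC
      (sub_le_sum_hitKer (b := 8) (fun x hx => by exact_mod_cast rightPot_mem hx)
        (fun v hv => drift_rightPot (valid_label v) (by rwa [mem_leftPart, not_not] at hv))
        (by norm_num) v)
    obtain ⟨p, hp0, hpa, hpv⟩ := this
    refine ⟨p, hp0, le_trans (by norm_num) (hpa.trans (le_of_eq ?_)), fun y => ?_⟩
    · congr 2
      ring
    · refine le_trans (le_of_eq ?_) (hpv y)
      congr 2
      ring
  refine (mixTime_le_of_dominatesMix hP hπ (rev_walkMat hG) (fun v => ?_) lastLevel_nonempty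
    hdom).trans ?_
  · simp [walkMat]
  · nlinarith

end Raw

namespace Raw

open Function

variable {h : ℕ}

/-- The value of the supermartingale at an edge whose lower end is at level `t`. -/
def lvl (h t : ℕ) : ℝ := (14 / 15) ^ (h - t)

/-- The value, relative to `lvl`, at the edge leading upwards from a vertex of depth `s` of a
trap. -/
def trapUp (s : ℕ) : ℝ := 1 / 5 + 8 / 5 * (1 / 2) ^ s

/-- A positive function of directed edges which increases slowly along the non-backtracking
walk. -/
def edgePot (h : ℕ) : Raw → Raw → ℝ
  | node t _, node t' _ => lvl h (max t t')
  | node t _, path t' _ _ => if t = t' then 4 / 5 * lvl h (t' + 1) else lvl h (t' + 1)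
  | node _ _, trap t' _ _ => 1 / 5 * lvl h (t' + 1)
  | path t _ _, node t' _ => if t = t' then lvl h (t + 1) else 4 / 5 * lvl h (t + 1)
  | path t _ i, path _ _ j => if j < i then lvl h (t + 1) else 4 / 5 * lvl h (t + 1)
  | path _ _ _, trap _ _ _ => 1
  | trap t _ _, node _ _ => lvl h (t + 1)
  | trap _ _ _, path _ _ _ => 1
  | trap t _ x, trap _ _ y => (if y = x / 2 then trapUp (heapDepth x) else 1 / 5) * lvl h (t + 1)

lemma lvl_pos (t : ℕ) : 0 < lvl h t := by
  rw [lvl]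
  positivity

lemma lvl_of_lt {t : ℕ} (ht : t < h) : lvl h t = 14 / 15 * lvl h (t + 1) := by
  rw [lvl, lvl, show h - t = h - (t + 1) + 1 by omega, pow_succ, mul_comm]

lemma lvl_of_le {t : ℕ} (ht : h ≤ t) : lvl h t = 1 := by
  rw [lvl, Nat.sub_eq_zero_of_le ht, pow_zero]

lemma trapUp_pos (s : ℕ) : 0 < trapUp s := by
  rw [trapUp]
  positivity

lemma edgePot_pos (x y : Raw) : 0 < edgePot h x y := by
  have h1 := lvl_pos (h := h)
  rcases x with ⟨t, w⟩ | ⟨t, w, i⟩ | ⟨t, w, i⟩ <;> rcases y with ⟨t', w'⟩ | ⟨t', w', j⟩ | ⟨t', w', j⟩ <;>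
    simp only [edgePot] <;> (try split_ifs) <;>
    first
      | exact h1 _
      | exact mul_pos (by first | exact trapUp_pos _ | norm_num) (h1 _)
      | norm_num

lemma edgePot_pt_succ {t i : ℕ} (w : ℕ → Fin 3) (h1 : 1 ≤ i) :
    edgePot h (path t w i) (pt h t w (i + 1)) = 4 / 5 * lvl h (t + 1) ∧
    edgePot h (pt h t w (i + 1)) (path t w i) = lvl h (t + 1) := by
  rw [pt, if_neg (by omega)]
  split_ifs <;> simp [edgePot]

lemma edgePot_pt_pred {t i : ℕ} (w : ℕ → Fin 3) (h1 : 1 ≤ i) (h2 : i < h) :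
    edgePot h (path t w i) (pt h t w (i - 1)) = lvl h (t + 1) ∧
    edgePot h (pt h t w (i - 1)) (path t w i) = 4 / 5 * lvl h (t + 1) := by
  rw [pt]
  split_ifs
  · simp [edgePot]
  · omega
  · simp only [edgePot]
    rw [if_pos (by omega), if_neg (by omega)]
    simp

lemma edgePot_tp {t x : ℕ} (w : ℕ → Fin 3) (h1 : 1 ≤ x) :
    edgePot h (trap t w x) (tp t w (x / 2)) = trapUp (heapDepth x) * lvl h (t + 1) ∧
    edgePot h (tp t w (x / 2)) (trap t w x) = 1 / 5 * lvl h (t + 1) := by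
  rw [tp]
  split_ifs with h2
  · have : x = 1 := by omega
    subst this
    simp only [edgePot, trapUp, heapDepth]
    norm_num
  · rw [edgePot, edgePot, if_pos rfl, if_neg (by omega)]
    simp

lemma le_of_le_mul {S L r q : ℝ} (hL : 1 ≤ L) (hr : 0 ≤ r) (hq : 0 ≤ q) {p : ℝ}
    (hS : S ≤ p + (L - 1) * q) : S ≤ p + (L - 1) * (1 + 2 * r) * q := by
  have : 0 ≤ (L - 1) * r * q := mul_nonneg (mul_nonneg (sub_nonneg.2 hL) hr) hq
  linarith

lemma edgePot_step_path {t i : ℕ} {w : ℕ → Fin 3} (hx : Valid h (path t w i)) {y : Raw}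
    (hy : y ∈ nb h (path t w i)) : ((nb h (path t w i)).map (edgePot h (path t w i))).sum ≤
      edgePot h (path t w i) y + (((nb h (path t w i)).length : ℝ) - 1) *
        edgePot h y (path t w i) := by
  obtain ⟨hl, h1, h2⟩ := hx
  have e1 := edgePot_pt_succ (h := h) (t := t) w h1
  have e2 := edgePot_pt_pred (t := t) w h1 h2
  simp only [nb, List.mem_cons, List.not_mem_nil, or_false] at hy
  simp only [nb, List.map_cons, List.map_nil, List.sum_cons, List.sum_nil, List.length_cons,
    List.length_nil, e1.1, e2.1]
  obtain rfl | rfl := hy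
  · rw [e2.1, e2.2]
    norm_num
  · rw [e1.1, e1.2]
    norm_num
    linarith

lemma edgePot_step_trap (hh : 2 ≤ h) (he : h % 2 = 0) {t x : ℕ} {w : ℕ → Fin 3}
    (hx : Valid h (trap t w x)) {y : Raw}
    (hy : y ∈ nb h (trap t w x)) : ((nb h (trap t w x)).map (edgePot h (trap t w x))).sum ≤
      edgePot h (trap t w x) y + (((nb h (trap t w x)).length : ℝ) - 1) *
        (1 + 2 * (4 / (h : ℝ) ^ 2)) * edgePot h y (trap t w x) := by
  obtain ⟨hl, h1, h2⟩ := hx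
  have hm' : (h * h) % 2 = 0 := by simp [Nat.mul_mod, he]
  have e1 := edgePot_tp (h := h) (t := t) w h1
  have hq := lvl_pos (h := h) (t + 1)
  have hr : (0 : ℝ) ≤ 4 / (h : ℝ) ^ 2 := by positivity
  by_cases hxm : x < h * h
  · rw [nb, if_pos hxm] at hy ⊢
    simp only [List.mem_cons, List.not_mem_nil, or_false] at hy
    simp only [List.map_cons, List.map_nil, List.sum_cons, List.sum_nil, List.length_cons,
      List.length_nil, e1.1]
    have e2 : ∀ z, x < z → edgePot h (trap t w x) (trap t w z) = 1 / 5 * lvl h (t + 1) := by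
      intro z hz
      rw [edgePot, if_neg (by omega)]
    have e3 : ∀ z, z / 2 = x → edgePot h (trap t w z) (trap t w x) =
        (1 / 10 + trapUp (heapDepth x) / 2) * lvl h (t + 1) := by
      intro z hz
      rw [edgePot, if_pos hz.symm, heapDepth_eq (by omega : 1 ≤ z), hz, trapUp, trapUp, pow_succ]
      ring
    rw [e2 _ (by omega), e2 _ (by omega)]
    refine le_of_le_mul (by norm_num) hr (edgePot_pos _ _).le ?_
    obtain rfl | rfl | rfl := hy
    · rw [e1.1, e1.2]
      push_cast
      linarith
    · rw [e2 _ (by omega), e3 _ (by omega)]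
      push_cast
      linarith
    · rw [e2 _ (by omega), e3 _ (by omega)]
      push_cast
      linarith
  · have h3 := le_sib hm' (not_lt.1 hxm)
    have h4 : 2 * 2 ≤ h * h := Nat.mul_le_mul hh hh
    have h5 : sib x ≠ x / 2 ∧ x ≠ sib x / 2 := by
      simp only [sib]
      split_ifs <;> omega
    rw [nb, if_neg hxm] at hy ⊢
    simp only [List.mem_cons, List.not_mem_nil, or_false] at hy
    have e2 : edgePot h (trap t w x) (trap t w (sib x)) = 1 / 5 * lvl h (t + 1) := by
      rw [edgePot, if_neg h5.1]
    have e3 : edgePot h (trap t w (sib x)) (trap t w x) = 1 / 5 * lvl h (t + 1) := by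
      rw [edgePot, if_neg h5.2]
    simp only [List.map_cons, List.map_nil, List.sum_cons, List.sum_nil, List.length_cons,
      List.length_nil, e1.1, e2]
    obtain rfl | rfl := hy
    · refine le_of_le_mul (by norm_num) hr (edgePot_pos _ _).le ?_
      rw [e1.1, e1.2]
      push_cast
      linarith
    · rw [e2, e3]
      have h6 : (1 / 2 : ℝ) ^ heapDepth x ≤ 1 / (h : ℝ) ^ 2 := by
        rw [one_div_pow]
        refine one_div_le_one_div_of_le (by positivity) ?_
        have := lt_two_pow_heapDepth x
        have : h ^ 2 ≤ 2 ^ heapDepth x := by nlinarith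
        exact_mod_cast this
      rw [trapUp]
      have h7 : 8 / 5 * (1 / 2 : ℝ) ^ heapDepth x ≤ 2 * (4 / (h : ℝ) ^ 2) * (1 / 5) := by
        calc _ ≤ 8 / 5 * (1 / (h : ℝ) ^ 2) := by linarith
          _ = _ := by ring
      push_cast
      nlinarith

lemma edgePot_step_node (hh : 2 ≤ h) {t : ℕ} {w : ℕ → Fin 3} (hx : Valid h (node t w)) {y : Raw}
    (hy : y ∈ nb h (node t w)) : ((nb h (node t w)).map (edgePot h (node t w))).sum ≤
      edgePot h (node t w) y + (((nb h (node t w)).length : ℝ) - 1) *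
        edgePot h y (node t w) := by
  have hq := lvl_pos (h := h) (t + 1)
  by_cases ht : t < h
  · have hR : right h t w = [node (t + 1) (update w t 0), node (t + 1) (update w t 1),
        path t (update w t 2) 1] := by
      rw [right, if_pos (by omega), child_long _ ht, child_short _ (by omega) (by simp),
        child_short _ (by omega) (by simp)]
    obtain _ | t := t
    · rw [nb, left, List.nil_append, hR] at hy ⊢
      simp only [List.mem_cons, List.not_mem_nil, or_false] at hy
      simp only [List.map_cons, List.map_nil, List.sum_cons, List.sum_nil, List.length_cons,
        List.length_nil]
      obtain rfl | rfl | rfl := hy <;> simp [edgePot] <;> linarith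
    have hq' := lvl_of_lt ht
    by_cases hw : t < h ∧ w t = 2
    · rw [nb, left_long hw.1 hw.2, hR] at hy ⊢
      simp only [List.cons_append, List.nil_append, List.mem_cons, List.not_mem_nil, or_false] at hy
      simp only [List.cons_append, List.nil_append, List.map_cons, List.map_nil, List.sum_cons,
        List.sum_nil, List.length_cons, List.length_nil]
      obtain rfl | rfl | rfl | rfl | rfl := hy <;> simp [edgePot] <;> rw [hq'] <;> linarith
    · rw [nb, left_short (by omega) hw, hR] at hy ⊢
      simp only [List.cons_append, List.nil_append, List.mem_cons, List.not_mem_nil, or_false] at hy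
      simp only [List.cons_append, List.nil_append, List.map_cons, List.map_nil, List.sum_cons,
        List.sum_nil, List.length_cons, List.length_nil]
      obtain rfl | rfl | rfl | rfl := hy <;> simp [edgePot] <;> rw [hq'] <;> linarith
  · have h1 : ∀ s, h ≤ s → lvl h s = 1 := fun s => lvl_of_le
    obtain _ | t := t
    · omega
    by_cases hw : t < h ∧ w t = 2
    · have hR : right h (t + 1) w = [node (t + 1 + 1) (update w (t + 1) 0),
          node (t + 1 + 1) (update w (t + 1) 1), node (t + 1 + 1) (update w (t + 1) 2)] := by
        rw [right, if_pos (by omega), child_short _ (by omega) (by omega),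
          child_short _ (by omega) (by omega), child_short _ (by omega) (by omega)]
      rw [nb, left_long hw.1 hw.2, hR] at hy ⊢
      simp only [List.cons_append, List.nil_append, List.mem_cons, List.not_mem_nil, or_false] at hy
      simp only [List.cons_append, List.nil_append, List.map_cons, List.map_nil, List.sum_cons,
        List.sum_nil, List.length_cons, List.length_nil]
      obtain rfl | rfl | rfl | rfl | rfl := hy <;>
        simp [edgePot, h1 (t + 1) (by omega), h1 (t + 1 + 1) (by omega)] <;> norm_num
    · have hN : ∀ z ∈ nb h (node (t + 1) w), ∃ t' w', z = node t' w' := by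
        intro z hz
        rw [nb, List.mem_append, left, right] at hz
        simp only [child] at hz
        split_ifs at hz <;> simp at hz <;> grind
      have h2 : ∀ z ∈ nb h (node (t + 1) w), edgePot h (node (t + 1) w) z = 1 ∧
          edgePot h z (node (t + 1) w) = 1 := by
        intro z hz
        obtain ⟨t', w', rfl⟩ := hN z hz
        exact ⟨h1 _ (by omega), h1 _ (by omega)⟩
      rw [(h2 y hy).1, (h2 y hy).2, List.map_congr_left fun z hz => (h2 z hz).1]
      simp

lemma edgePot_step (hh : 2 ≤ h) (he : h % 2 = 0) {x y : Raw} (hx : Valid h x) (hy : y ∈ nb h x) :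
    ((nb h x).map (edgePot h x)).sum ≤ edgePot h x y +
      (((nb h x).length : ℝ) - 1) * (1 + 2 * (4 / (h : ℝ) ^ 2)) * edgePot h y x := by
  have hL : (1 : ℝ) ≤ (nb h x).length := by
    have := two_le_length_nb hh hx
    exact_mod_cast (by omega : 1 ≤ (nb h x).length)
  rcases x with ⟨t, w⟩ | ⟨t, w, i⟩ | ⟨t, w, i⟩
  · exact le_of_le_mul hL (by positivity) (edgePot_pos _ _).le (edgePot_step_node hh hx hy)
  · exact le_of_le_mul hL (by positivity) (edgePot_pos _ _).le (edgePot_step_path hx hy)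
  · exact edgePot_step_trap hh he hx hy

variable [hS : Fact (GoodSize h)]

lemma nbrwMat_gGraph_step (e : dirEdges (gGraph h)) :
    ∑ e', nbrwMat (gGraph h) e e' * edgePot h (label (eSrc e')) (label (eDst e')) ≤
      (1 + 4 / (h : ℝ) ^ 2) * edgePot h (label (eSrc e)) (label (eDst e)) := by
  refine nbrwMat_step_le (fun v => two_le_deg v)
    (φ := fun u v => edgePot h (label u) (label v)) e ?_
  rw [nbrSum_label (eDst e) (edgePot h (label (eDst e))), deg_gGraph]
  exact edgePot_step two_le even_size (valid_label _)
    (gGraph_adj.1 (adj_eSrc_eDst e).symm)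

open Classical in
variable (h) in
/-- The vertices which are not nodes at a level larger than `h`. -/
def lowPart : Finset (Fin (gSize h)) :=
  univ.filter fun v => ¬ ∃ t w, label v = node t w ∧ h < t

lemma mem_lowPart {v : Fin (gSize h)} :
    v ∈ lowPart h ↔ ¬ ∃ t w, label v = node t w ∧ h < t := by
  simp [lowPart]

lemma card_lowPart_le : #(lowPart h) ≤ (h + 1) * (3 ^ h * (h + 2 * (h * h))) := by
  refine card_le_codes _ le_rfl fun v hv => ?_
  rw [mem_lowPart] at hv
  have hl : ∀ t w, label v = node t w → t ≤ h := fun t w htw => by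
    by_contra ht
    exact hv ⟨t, w, htw, by omega⟩
  refine ⟨?_, hl⟩
  have hv := valid_label v
  rcases hx : label v with ⟨t, w⟩ | ⟨t, w, i⟩ | ⟨t, w, i⟩ <;> rw [hx] at hv
  · have := hl t w hx
    exact fun i hi => hv.2 i (by omega)
  · exact fun i hi => hv.1.2.2 i (by have := hv.1.1; omega)
  · exact fun i hi => hv.1.2.2 i (by have := hv.1.1; omega)

lemma quadratic_le_three_pow : 24 * (h + 1) * (h + 2 * (h * h)) ≤ 3 ^ h := by
  have key : ∀ n : ℕ, 24 * (n + 65) * ((n + 64) + 2 * ((n + 64) * (n + 64))) ≤ 3 ^ (n + 64) := by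
    intro n
    induction n with
    | zero => norm_num
    | succ n ih =>
      rw [show n + 1 + 64 = n + 64 + 1 by ring, pow_succ]
      nlinarith
  have := sixtyFour_le (h := h)
  obtain ⟨n, rfl⟩ : ∃ n, h = n + 64 := ⟨h - 64, by omega⟩
  exact key n

/-- The stationary weight of the edges between nodes of level larger than `h`. -/
lemma sum_nbrwSta_high [Nonempty (dirEdges (gGraph h))] :
    3 / 4 ≤ ∑ e ∈ univ.filter (fun e : dirEdges (gGraph h) =>
      eSrc e ∉ lowPart h ∧ eDst e ∉ lowPart h), nbrwSta (gGraph h) e := by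
  classical
  set low : Fin (gSize h) → ℝ := fun v => if v ∈ lowPart h then 1 else 0 with hlow
  have hlow0 : ∀ v, 0 ≤ low v := fun v => by simp only [hlow]; positivity
  have hE : (Nat.card (dirEdges (gGraph h)) : ℝ) = ∑ v, (deg (gGraph h) v : ℝ) := by
    have h1 := sum_dirEdges (G := gGraph h) fun _ _ => (1 : ℝ)
    simp only [sum_const, card_univ, nsmul_eq_mul, mul_one] at h1
    rw [Nat.card_eq_fintype_card, h1]
    refine sum_congr rfl fun v _ => ?_
    have := nbrSum_const (G := gGraph h) v 1
    rw [mul_one] at this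
    exact this
  have hsrc : ∑ e : dirEdges (gGraph h), low (eSrc e) ≤ 6 * #(lowPart h) := by
    rw [sum_dirEdges fun u _ => low u]
    have h1 : ∀ v, (∑ u, if (gGraph h).Adj v u then low v else 0) ≤ 6 * low v := by
      intro v
      have h2 := nbrSum_const (G := gGraph h) v (low v)
      rw [nbrSum] at h2
      rw [h2]
      exact mul_le_mul_of_nonneg_right (by exact_mod_cast deg_le_six v) (hlow0 v)
    refine (sum_le_sum fun v _ => h1 v).trans (le_of_eq ?_)
    rw [← mul_sum]
    simp [hlow]
  have hdst : ∑ e : dirEdges (gGraph h), low (eDst e) = ∑ e : dirEdges (gGraph h), low (eSrc e) := by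
    rw [sum_dirEdges fun u _ => low u, sum_dirEdges fun _ v => low v, sum_comm]
    refine sum_congr rfl fun u _ => sum_congr rfl fun v _ => ?_
    exact if_congr ((gGraph h).adj_comm _ _) rfl rfl
  have hlarge : 2 * (3 : ℝ) ^ (2 * h) ≤ Nat.card (dirEdges (gGraph h)) := by
    rw [hE]
    have h1 : ∑ v : Fin (gSize h), (2 : ℝ) ≤ ∑ v, (deg (gGraph h) v : ℝ) :=
      sum_le_sum fun v _ => by exact_mod_cast two_le_deg v
    have h2 : (3 : ℝ) ^ (2 * h) ≤ gSize h := by exact_mod_cast pow_le_gSize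
    simp only [sum_const, card_univ, Fintype.card_fin, nsmul_eq_mul] at h1
    linarith
  have hsmall : 12 * (#(lowPart h) : ℝ) ≤ 1 / 2 * 3 ^ (2 * h) := by
    have h1 := card_lowPart_le (h := h)
    have h2 := quadratic_le_three_pow (h := h)
    have h3 : 24 * #(lowPart h) ≤ 3 ^ (2 * h) := by
      calc 24 * #(lowPart h) ≤ 24 * ((h + 1) * (3 ^ h * (h + 2 * (h * h)))) := by gcongr
        _ = 24 * (h + 1) * (h + 2 * (h * h)) * 3 ^ h := by ring
        _ ≤ 3 ^ h * 3 ^ h := by gcongr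
        _ = 3 ^ (2 * h) := by rw [two_mul, pow_add]
    have h4 : 24 * (#(lowPart h) : ℝ) ≤ 3 ^ (2 * h) := by exact_mod_cast h3
    linarith
  have hpos : (0 : ℝ) < Nat.card (dirEdges (gGraph h)) :=
    lt_of_lt_of_le (by positivity) hlarge
  simp only [nbrwSta]
  rw [sum_const, nsmul_eq_mul, mul_one_div, le_div_iff₀ hpos]
  have hcount : (Nat.card (dirEdges (gGraph h)) : ℝ) - ∑ e : dirEdges (gGraph h), low (eSrc e) -
      ∑ e : dirEdges (gGraph h), low (eDst e) ≤ #(univ.filter (fun e : dirEdges (gGraph h) =>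
      eSrc e ∉ lowPart h ∧ eDst e ∉ lowPart h)) := by
    have h1 : (Nat.card (dirEdges (gGraph h)) : ℝ) = ∑ e : dirEdges (gGraph h), 1 := by
      rw [sum_const, card_univ, nsmul_eq_mul, mul_one, Nat.card_eq_fintype_card]
    rw [h1, card_filter, Nat.cast_sum, ← sum_sub_distrib, ← sum_sub_distrib]
    refine sum_le_sum fun e _ => ?_
    simp only [hlow]
    split_ifs <;> simp_all
  linarith

end Raw

namespace Raw

open Function Relation

/-- A step of the non-backtracking walk on pairs of adjacent labels. -/
def LabelStep (h : ℕ) (p q : Raw × Raw) : Prop := q.1 = p.2 ∧ q.2 ∈ nb h p.2 ∧ q.2 ≠ p.1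

/-- The non-backtracking walk can move from `p` to `q`. -/
def NBReach (h : ℕ) : Raw × Raw → Raw × Raw → Prop := ReflTransGen (LabelStep h)

variable {h : ℕ}

lemma NBReach.head {x y z : Raw} {q : Raw × Raw} (hz : z ∈ nb h y) (hne : z ≠ x)
    (hr : NBReach h (y, z) q) : NBReach h (x, y) q :=
  ReflTransGen.head ⟨rfl, hz, hne⟩ hr

lemma NBReach.valid (hh : 2 ≤ h) (he : h % 2 = 0) {p q : Raw × Raw} (hr : NBReach h p q)
    (hp : Valid h p.2) : Valid h q.2 := by
  induction hr with
  | refl => exact hp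
  | tail _ hs ih => exact valid_of_mem_nb hh he ih hs.2.1

/-- The non-backtracking walk can move from `p` to a pair ending in a node. -/
def ReachesNode (h : ℕ) (p : Raw × Raw) : Prop := ∃ x t w, NBReach h p (x, node t w)

lemma ReachesNode.head {x y z : Raw} (hz : z ∈ nb h y) (hne : z ≠ x)
    (hr : ReachesNode h (y, z)) : ReachesNode h (x, y) := by
  obtain ⟨x', t, w, hr⟩ := hr
  exact ⟨x', t, w, hr.head hz hne⟩

lemma reachesNode_node (x : Raw) (t : ℕ) (w : ℕ → Fin 3) : ReachesNode h (x, node t w) :=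
  ⟨x, t, w, ReflTransGen.refl⟩

lemma reachesNode_path_of_ne (t : ℕ) (w : ℕ → Fin 3) (i : ℕ) (hi : 1 ≤ i) (hih : i < h) (x : Raw)
    (hx : x ≠ pt h t w (i - 1)) : ReachesNode h (x, path t w i) := by
  induction i, hi using Nat.le_induction generalizing x with
  | base =>
    refine ReachesNode.head (z := pt h t w 0) (by simp [nb]) hx.symm ?_
    rw [pt_zero]
    exact reachesNode_node _ _ _
  | succ i hi ih =>
    refine ReachesNode.head (z := pt h t w i) (by simp [nb]) hx.symm ?_
    rw [pt, if_neg (by omega), if_neg (by omega)]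
    refine ih (by omega) _ ?_
    rw [pt]
    split_ifs <;> simp <;> omega

lemma reachesNode_path (t : ℕ) (w : ℕ → Fin 3) (i : ℕ) (hi : 1 ≤ i) (hih : i < h) (x : Raw) :
    ReachesNode h (x, path t w i) := by
  obtain ⟨k, hk⟩ : ∃ k, k = h - i := ⟨_, rfl⟩
  induction k generalizing i x with
  | zero => omega
  | succ k ih =>
    by_cases hx : x = pt h t w (i - 1)
    · refine ReachesNode.head (z := pt h t w (i + 1)) (by simp [nb]) ?_ ?_
      · subst hx
        simp only [pt]
        split_ifs <;> simp <;> omega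
      · rw [pt, if_neg (by omega)]
        split_ifs
        · exact reachesNode_node _ _ _
        · exact ih _ (by omega) (by omega) _ (by omega)
    · exact reachesNode_path_of_ne t w i hi hih x hx

lemma reachesNode_trap_of_ne (t : ℕ) (w : ℕ → Fin 3) (y : ℕ) (hy : 1 ≤ y) (x : Raw)
    (hx : x ≠ tp t w (y / 2)) : ReachesNode h (x, trap t w y) := by
  induction y using Nat.strong_induction_on generalizing x with
  | _ y ih =>
    refine ReachesNode.head (z := tp t w (y / 2)) (by simp [nb]) hx.symm ?_
    by_cases h0 : y / 2 = 0
    · rw [tp, if_pos h0]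
      exact reachesNode_node _ _ _
    · rw [tp, if_neg h0]
      refine ih _ (by omega) (by omega) _ ?_
      rw [tp]
      split_ifs <;> simp
      omega

lemma reachesNode_trap (hh : 2 ≤ h) (he : h % 2 = 0) (t : ℕ) (w : ℕ → Fin 3) (y : ℕ) (hy : 1 ≤ y)
    (x : Raw) : ReachesNode h (x, trap t w y) := by
  obtain ⟨k, hk⟩ : ∃ k, k = h * h - y := ⟨_, rfl⟩
  induction k using Nat.strong_induction_on generalizing y x with
  | _ k ih =>
    by_cases hx : x = tp t w (y / 2)
    · subst hx
      by_cases hyh : y < h * h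
      · refine ReachesNode.head (z := trap t w (2 * y)) (by simp [nb, hyh]) ?_ ?_
        · rw [tp]
          split_ifs <;> simp
          omega
        · exact ih (h * h - 2 * y) (by omega) _ (by omega) _ rfl
      · have hm : (h * h) % 2 = 0 := by simp [Nat.mul_mod, he]
        have h4 : 4 ≤ h * h := by nlinarith
        have hs := le_sib hm (not_lt.1 hyh)
        have hs' : sib y ≤ y + 1 := by rw [sib]; split_ifs <;> omega
        refine ReachesNode.head (z := trap t w (sib y)) (by simp [nb, hyh]) ?_ ?_
        · rw [tp]
          split_ifs <;> simp
          rw [sib]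
          split_ifs <;> omega
        · refine reachesNode_trap_of_ne t w _ (by omega) _ ?_
          rw [tp]
          split_ifs <;> simp
          omega
    · exact reachesNode_trap_of_ne t w y hy x hx

lemma reachesNode (hh : 2 ≤ h) (he : h % 2 = 0) (x : Raw) {y : Raw} (hy : Valid h y) :
    ReachesNode h (x, y) := by
  cases y with
  | node t w => exact reachesNode_node _ _ _
  | path t w i => exact reachesNode_path t w i hy.2.1 hy.2.2 x
  | trap t w y => exact reachesNode_trap hh he t w y hy.2.1 x

lemma exists_child_ne (x : Raw) {t : ℕ} (w : ℕ → Fin 3) (ht : t < 4 * h) :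
    ∃ w', node (t + 1) w' ∈ nb h (node t w) ∧ node (t + 1) w' ≠ x := by
  have key : ∀ c : Fin 3, c ≠ 2 → ∃ j, child h t w c = node (t + 1) (update w j c) ∧
      (j = if t < 2 * h then t else t - 2 * h) := by
    intro c hc
    rw [child]
    split_ifs with h1 h2
    · exact absurd h2.2 hc
    · exact ⟨_, rfl, rfl⟩
    · exact ⟨_, rfl, rfl⟩
  obtain ⟨j, h0, hj⟩ := key 0 (by decide)
  obtain ⟨j', h1, hj'⟩ := key 1 (by decide)
  obtain rfl : j = j' := hj.trans hj'.symm
  have hm : ∀ c, child h t w c ∈ nb h (node t w) := fun c => by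
    rw [nb, List.mem_append, mem_right_iff ht]
    exact Or.inr ⟨c, rfl⟩
  by_cases hx : node (t + 1) (update w j 0) = x
  · refine ⟨_, h1 ▸ hm 1, ?_⟩
    rw [← hx]
    simp [update_eq_update_iff]
  · exact ⟨_, h0 ▸ hm 0, hx⟩

lemma exists_reach_top (x : Raw) {t : ℕ} (w : ℕ → Fin 3) (ht : t ≤ 4 * h) :
    ∃ x' w', NBReach h (x, node t w) (x', node (4 * h) w') := by
  obtain ⟨k, hk⟩ := Nat.exists_eq_add_of_le ht
  induction k generalizing x t w with
  | zero => exact ⟨x, w, by rw [hk]; exact ReflTransGen.refl⟩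
  | succ k ih =>
    obtain ⟨w', hm, hne⟩ := exists_child_ne x w (show t < 4 * h by omega)
    obtain ⟨x'', w'', hr⟩ := ih (node t w) (t := t + 1) w' (by omega) (by omega)
    exact ⟨x'', w'', hr.head hm hne⟩

lemma exists_reach_below_top (hh : 2 ≤ h) (x : Raw) (w : ℕ → Fin 3) :
    ∃ w', NBReach h (x, node (4 * h) w) (node (4 * h) w, node (4 * h - 1) w') := by
  have hm : ∀ c, node (4 * h - 1) (update w (4 * h - 1 - 2 * h) c) ∈ nb h (node (4 * h) w) := by
    intro c
    obtain ⟨t, ht⟩ : ∃ t, 4 * h = t + 1 := ⟨4 * h - 1, by omega⟩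
    rw [nb, List.mem_append]
    left
    rw [ht, mem_left_butterfly_iff (by omega)]
    exact ⟨c, by simp⟩
  by_cases hx : node (4 * h - 1) (update w (4 * h - 1 - 2 * h) 0) = x
  · refine ⟨_, NBReach.head (hm 1) ?_ ReflTransGen.refl⟩
    rw [← hx]
    simp [update_eq_update_iff]
  · exact ⟨_, NBReach.head (hm 0) hx ReflTransGen.refl⟩

/-- Going left through the butterfly, the walk can choose the letters freely. -/
lemma exists_reach_butterfly (v : ℕ → Fin 3) (k : ℕ) {t : ℕ} (ht : t = 2 * h + k)
    (w u : ℕ → Fin 3) (hw : ∀ i, k ≤ i → i < 2 * h - 1 → w i = v i) :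
    ∃ w' u', (∀ i, i < 2 * h - 1 → w' i = v i) ∧
      NBReach h (node (t + 1) u, node t w) (node (2 * h + 1) u', node (2 * h) w') := by
  induction k generalizing t w u with
  | zero =>
    subst ht
    exact ⟨w, u, fun i hi => hw i (Nat.zero_le _) hi, ReflTransGen.refl⟩
  | succ k ih =>
    obtain rfl : t = 2 * h + k + 1 := by omega
    obtain ⟨w', u', hw', hr⟩ := ih (t := 2 * h + k) rfl (update w k (v k)) w (fun i hi hi' => by
      by_cases hik : i = k
      · rw [hik, update_self]
      · rw [update_of_ne hik]
        exact hw i (by omega) hi')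
    refine ⟨w', u', hw', hr.head ?_ (by simp; omega)⟩
    rw [nb, List.mem_append, mem_left_butterfly_iff (by omega)]
    exact Or.inl ⟨v k, by simp⟩

lemma reach_root {a : Fin 3} (ha : a ≠ 2) (t : ℕ) (hth : t + 1 < 2 * h) (u : ℕ → Fin 3) :
    NBReach h (node (t + 2) u, node (t + 1) (update 0 0 a))
      (node 1 (update 0 0 a), node 0 0) := by
  have hv2 : ∀ i, update (0 : ℕ → Fin 3) 0 a i ≠ 2 := by
    intro i
    by_cases hi : i = 0
    · rwa [hi, update_self]
    · rw [update_of_ne hi, Pi.zero_apply]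
      decide
  have hm : ∀ s, s < 2 * h → node s (update (update (0 : ℕ → Fin 3) 0 a) s 0) ∈
      nb h (node (s + 1) (update 0 0 a)) := by
    intro s hs
    rw [nb, List.mem_append, left, if_pos hs, if_neg (fun hc => hv2 s hc.2)]
    simp
  have hm0 := hm 0 (by omega)
  rw [update_idem, show update (0 : ℕ → Fin 3) 0 0 = 0 from update_eq_self 0 (0 : ℕ → Fin 3)] at hm0
  induction t generalizing u with
  | zero => exact NBReach.head hm0 (by simp) ReflTransGen.refl
  | succ t ih =>
    refine NBReach.head (hm (t + 1) (by omega)) (by simp) ?_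
    rw [show update (update (0 : ℕ → Fin 3) 0 a) (t + 1) 0 = update (0 : ℕ → Fin 3) 0 a from
      update_eq_self_iff.2 (by simp)]
    exact ih (by omega) _

/-- Every pair of adjacent labels reaches every short edge leading to the root. -/
lemma reach_root_edge (hh : 2 ≤ h) (he : h % 2 = 0) (x : Raw) {y : Raw} (hy : Valid h y)
    {a : Fin 3} (ha : a ≠ 2) :
    NBReach h (x, y) (node 1 (update 0 0 a), node 0 0) := by
  obtain ⟨x₁, t, w₁, hr₁⟩ := reachesNode hh he x hy
  have hv₁ := hr₁.valid hh he hy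
  obtain ⟨x₂, w₂, hr₂⟩ := exists_reach_top x₁ w₁ hv₁.1
  obtain ⟨w₃, hr₃⟩ := exists_reach_below_top hh x₂ w₂
  obtain ⟨w₄, u₄, hw₄, hr₄⟩ := exists_reach_butterfly (h := h) (update (0 : ℕ → Fin 3) 0 a) (2 * h - 1)
    (t := 4 * h - 1) (by omega) w₃ w₂ (fun i hi hi' => by omega)
  rw [Nat.sub_add_cancel (by omega)] at hr₄
  have hr : NBReach h (x, y) (node (2 * h + 1) u₄, node (2 * h) w₄) :=
    ((hr₁.trans hr₂).trans hr₃).trans hr₄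
  have hv := hr.valid hh he hy
  obtain ⟨s, hs⟩ : ∃ s, 2 * h = s + 2 := ⟨2 * h - 2, by omega⟩
  have hup : update w₄ (s + 1) 0 = update (0 : ℕ → Fin 3) 0 a := by
    funext i
    by_cases hi : i = s + 1
    · rw [hi, update_self, update_of_ne (by omega)]
      rfl
    · rw [update_of_ne hi]
      by_cases hi' : i < 2 * h - 1
      · exact hw₄ i hi'
      · rw [update_of_ne (by omega)]
        exact hv.2 i (by omega)
  refine hr.trans (NBReach.head (z := node (s + 1) (update 0 0 a)) ?_ (by simp; omega) ?_)
  · rw [nb, List.mem_append, hs, left, if_pos (by omega), if_neg (fun hc => by omega), hup]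
    simp
  · rw [hs]
    exact reach_root ha s (by omega) _

end Raw

open Raw

variable {h : ℕ} [hS : Fact (GoodSize h)]

/-- The pair of labels of the ends of a directed edge. -/
def edgeLabel (e : dirEdges (gGraph h)) : Raw × Raw := (label (eSrc e), label (eDst e))

lemma exists_edge_of_nbReach {e : dirEdges (gGraph h)} {q : Raw × Raw}
    (hr : NBReach h (edgeLabel e) q) :
    ∃ e', edgeLabel e' = q ∧ Relation.ReflTransGen (NBStep (gGraph h)) e e' := by
  induction hr with
  | refl => exact ⟨e, rfl, Relation.ReflTransGen.refl⟩
  | @tail p q _ hs ih =>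
    obtain ⟨e', rfl, hr'⟩ := ih
    obtain ⟨q1, q2⟩ := q
    obtain ⟨h1, h2, h3⟩ := hs
    simp only at h1 h2 h3
    subst h1
    have hv : Valid h q2 := valid_of_mem_nb two_le even_size (valid_label _) h2
    refine ⟨eMk (G := gGraph h) (u := eDst e') (v := vert hv) ?_, ?_, hr'.tail ⟨?_, ?_⟩⟩
    · rw [gGraph_adj, label_vert]
      exact h2
    · simp [edgeLabel]
    · simp
    · rw [eDst_eMk]
      intro hc
      apply h3
      simp [edgeLabel, ← hc]

lemma exists_reach_root_edge (e : dirEdges (gGraph h)) {a : Fin 3} (ha : a ≠ 2) :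
    ∃ e', edgeLabel e' = (node 1 (Function.update 0 0 a), node 0 0) ∧
      Relation.ReflTransGen (NBStep (gGraph h)) e e' :=
  exists_edge_of_nbReach (reach_root_edge two_le even_size _ (valid_label _) ha)

/-- The non-backtracking walk is irreducible. -/
lemma nbReach_gGraph (e e' : dirEdges (gGraph h)) :
    Relation.ReflTransGen (NBStep (gGraph h)) e e' := by
  obtain ⟨e₀, hl₀, hr₀⟩ := exists_reach_root_edge e (a := 0) (by decide)
  obtain ⟨e₁, hl₁, hr₁⟩ := exists_reach_root_edge (dirEdgeRev e') (a := 1) (by decide)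
  have hs : NBStep (gGraph h) e₀ (dirEdgeRev e₁) := by
    refine ⟨label_injective ?_, fun hc => ?_⟩
    · exact (congrArg Prod.snd hl₁).trans (congrArg Prod.snd hl₀).symm
    · have h1 : label (eSrc e₁) = label (eSrc e₀) := congrArg label hc
      rw [show label (eSrc e₁) = _ from congrArg Prod.fst hl₁,
        show label (eSrc e₀) = _ from congrArg Prod.fst hl₀] at h1
      simp at h1
  exact (hr₀.tail hs).trans (nbReach_rev hr₁)

lemma exists_adj (v : Fin (gSize h)) : ∃ u, (gGraph h).Adj v u := by
  have hd : 0 < deg (gGraph h) v := lt_of_lt_of_le (by norm_num) (two_le_deg v)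
  have := (Nat.card_pos_iff.1 hd).1
  exact ⟨_, (Classical.arbitrary {u // (gGraph h).Adj v u}).2⟩

lemma reachable_of_nbReach {G : SimpleGraph V} {e e' : dirEdges G}
    (hr : Relation.ReflTransGen (NBStep G) e e') : G.Reachable (eSrc e) (eSrc e') := by
  induction hr with
  | refl => exact SimpleGraph.Reachable.refl _
  | @tail p q _ hs ih =>
    rw [hs.1]
    exact ih.trans (adj_eSrc_eDst p).reachable

lemma connected_gGraph : (gGraph h).Connected := by
  have : Nonempty (Fin (gSize h)) := inferInstance
  refine ⟨fun u v => ?_⟩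
  obtain ⟨u', hu⟩ := exists_adj u
  obtain ⟨v', hv⟩ := exists_adj v
  exact reachable_of_nbReach (nbReach_gGraph (eMk hu) (eMk hv))

instance : Nonempty (dirEdges (gGraph h)) :=
  let ⟨_, hu⟩ := exists_adj (Classical.arbitrary (Fin (gSize h)))
  ⟨eMk hu⟩

lemma exists_dTV_gGraph_le :
    ∃ t, dTV (nbrwMat (gGraph h)) (nbrwSta (gGraph h)) t ≤ 1 / 4 :=
  exists_dTV_nbrwMat_le two_le_deg nbReach_gGraph

open Raw

variable {h : ℕ} [hS : Fact (GoodSize h)]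

lemma edgePot_of_notMem_lowPart {u v : Fin (gSize h)} (hu : u ∉ lowPart h) (hv : v ∉ lowPart h) :
    1 ≤ edgePot h (label u) (label v) := by
  rw [mem_lowPart, not_not] at hu hv
  obtain ⟨t, w, hu, ht⟩ := hu
  obtain ⟨t', w', hv, _⟩ := hv
  rw [hu, hv, edgePot, lvl_of_le (le_trans ht.le (le_max_left _ _))]

lemma exists_edgePot_eq :
    ∃ e : dirEdges (gGraph h), edgePot h (label (eSrc e)) (label (eDst e)) = (14 / 15) ^ (h - 1) := by
  obtain ⟨e, hl, _⟩ := exists_reach_root_edge (Classical.arbitrary (dirEdges (gGraph h)))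
    (a := 0) (by decide)
  refine ⟨dirEdgeRev e, ?_⟩
  rw [show label (eSrc (dirEdgeRev e)) = _ from congrArg Prod.snd hl,
    show label (eDst (dirEdgeRev e)) = _ from congrArg Prod.fst hl, edgePot, lvl]
  simp

lemma growth_mul_pow_le {T : ℕ} (hT : (T : ℝ) ≤ (h : ℝ) ^ 3 / 160) :
    (1 + 4 / (h : ℝ) ^ 2) ^ T * (14 / 15) ^ (h - 1) ≤ 1 / 4 := by
  have h0 := real_sixtyFour_le (h := h)
  have h1 : (1 + 4 / (h : ℝ) ^ 2) ^ T ≤ Real.exp (h / 40) := by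
    calc (1 + 4 / (h : ℝ) ^ 2) ^ T ≤ Real.exp (4 / (h : ℝ) ^ 2) ^ T := by
          gcongr
          rw [add_comm]
          exact Real.add_one_le_exp _
      _ = Real.exp (T * (4 / (h : ℝ) ^ 2)) := (Real.exp_nat_mul _ _).symm
      _ ≤ Real.exp (h / 40) := by
          gcongr
          calc (T : ℝ) * (4 / (h : ℝ) ^ 2) ≤ (h : ℝ) ^ 3 / 160 * (4 / (h : ℝ) ^ 2) := by gcongr
            _ = (h : ℝ) / 40 := by field_simp; norm_num
  have h2 : (14 / 15 : ℝ) ^ (h - 1) ≤ Real.exp (-((h - 1) / 15)) := by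
    calc (14 / 15 : ℝ) ^ (h - 1) ≤ Real.exp (-(1 / 15)) ^ (h - 1) := by
          gcongr
          have := Real.add_one_le_exp (-(1 / 15 : ℝ))
          linarith
      _ = Real.exp ((h - 1 : ℕ) * (-(1 / 15))) := (Real.exp_nat_mul _ _).symm
      _ = Real.exp (-((h - 1) / 15)) := by
          rw [Nat.cast_sub (by have := sixtyFour_le (h := h); omega)]
          congr 1
          push_cast
          ring
  calc (1 + 4 / (h : ℝ) ^ 2) ^ T * (14 / 15) ^ (h - 1)
      ≤ Real.exp (h / 40) * Real.exp (-((h - 1) / 15)) := by gcongr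
    _ = Real.exp (h / 40 + -((h - 1) / 15)) := (Real.exp_add _ _).symm
    _ ≤ Real.exp (-2) := by
        gcongr
        linarith
    _ ≤ 1 / 4 := by
        rw [Real.exp_neg, one_div]
        gcongr
        have h3 := Real.exp_one_gt_d9
        rw [show (2 : ℝ) = 1 + 1 by norm_num, Real.exp_add]
        nlinarith

lemma le_mixTime_gGraph {T : ℕ} (hT : (T : ℝ) ≤ (h : ℝ) ^ 3 / 160) :
    T ≤ mixTime (nbrwMat (gGraph h)) (nbrwSta (gGraph h)) (1 / 4) := by
  classical
  obtain ⟨e₀, he₀⟩ := exists_edgePot_eq (h := h)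
  refine le_mixTime_of_supermartingale (isStoch_nbrwMat two_le_deg) sum_nbrwSta
    exists_dTV_gGraph_le (q := 1 + 4 / (h : ℝ) ^ 2) ?_
    (φ := fun e => edgePot h (label (eSrc e)) (label (eDst e))) (fun e => (edgePot_pos _ _).le)
    nbrwMat_gGraph_step
    (B := univ.filter fun e => eSrc e ∉ lowPart h ∧ eDst e ∉ lowPart h) ?_ ?_ (x := e₀) ?_
  · have : (0 : ℝ) ≤ 4 / (h : ℝ) ^ 2 := by positivity
    linarith
  · intro e he
    rw [mem_filter] at he
    exact edgePot_of_notMem_lowPart he.2.1 he.2.2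
  · convert sum_nbrwSta_high (h := h)
  · simp only [he₀]
    exact growth_mul_pow_le hT

lemma cube_le_mixTime :
    (h : ℝ) ^ 3 / 320 ≤ mixTime (nbrwMat (gGraph h)) (nbrwSta (gGraph h)) (1 / 4) := by
  have h0 := real_sixtyFour_le (h := h)
  have h1 : (64 : ℝ) ^ 3 ≤ (h : ℝ) ^ 3 := by gcongr
  have h2 := le_mixTime_gGraph (h := h) (T := ⌊(h : ℝ) ^ 3 / 160⌋₊)
    (Nat.floor_le (by positivity))
  have h3 : ((⌊(h : ℝ) ^ 3 / 160⌋₊ : ℕ) : ℝ) ≤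
      mixTime (nbrwMat (gGraph h)) (nbrwSta (gGraph h)) (1 / 4) := by exact_mod_cast h2
  have h4 := Nat.lt_floor_add_one ((h : ℝ) ^ 3 / 160)
  linarith

lemma log_gSize_le : Real.log (gSize h) ≤ 10 * h := by
  have h1 : gSize h ≤ 3 ^ (5 * h) := by
    have h2 := gSize_le (h := h)
    have h3 := quadratic_le_three_pow (h := h)
    calc gSize h ≤ (4 * h + 1) * (3 ^ (2 * h) * (h + 2 * (h * h))) := h2
      _ = 3 ^ (2 * h) * ((4 * h + 1) * (h + 2 * (h * h))) := by ring
      _ ≤ 3 ^ (2 * h) * (24 * (h + 1) * (h + 2 * (h * h))) := by gcongr; omega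
      _ ≤ 3 ^ (2 * h) * 3 ^ h := by gcongr
      _ = 3 ^ (3 * h) := by rw [← pow_add]; congr 1; omega
      _ ≤ 3 ^ (5 * h) := by gcongr <;> omega
  have h2 : (gSize h : ℝ) ≤ 3 ^ (5 * h) := by exact_mod_cast h1
  have h3 : (0 : ℝ) < gSize h := by
    have := pow_le_gSize (h := h)
    have : 0 < gSize h := lt_of_lt_of_le (by positivity) this
    exact_mod_cast this
  calc Real.log (gSize h) ≤ Real.log (3 ^ (5 * h)) := Real.log_le_log h3 h2
    _ = 5 * h * Real.log 3 := by rw [Real.log_pow]; push_cast; ring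
    _ ≤ 5 * h * 2 := by
        gcongr
        have := Real.log_le_sub_one_of_pos (show (0 : ℝ) < 3 by norm_num)
        linarith
    _ = 10 * h := by ring

lemma log_mul_tmixG_le :
    1 / 10 ^ 8 * Real.log (gSize h) * (tmixG (gGraph h) (1 / 4) : ℝ) ≤
      mixTime (nbrwMat (gGraph h)) (nbrwSta (gGraph h)) (1 / 4) := by
  have h1 : (tmixG (gGraph h) (1 / 4) : ℝ) ≤ 28000 * (h : ℝ) ^ 2 := by
    exact_mod_cast tmixG_gGraph_le (h := h)
  have h2 := log_gSize_le (h := h)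
  refine le_trans ?_ (cube_le_mixTime (h := h))
  calc 1 / 10 ^ 8 * Real.log (gSize h) * (tmixG (gGraph h) (1 / 4) : ℝ)
      ≤ 1 / 10 ^ 8 * (10 * h) * (28000 * (h : ℝ) ^ 2) := by gcongr
    _ = 28 / 10000 * (h : ℝ) ^ 3 := by ring
    _ ≤ (h : ℝ) ^ 3 / 320 := by
        have : (0 : ℝ) ≤ (h : ℝ) ^ 3 := by positivity
        linarith

lemma goodSize_two_mul (n : ℕ) : GoodSize (2 * (n + 32)) := ⟨by omega, by omega⟩

/-- **Remark 4.4.** There is a sequence of bounded degree graphs (with minimum degree `≥ 2`)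
on which the mixing time of the lazy non-backtracking random walk is larger than that of the
LSRW by a factor of `Θ(log |V_n|)`. -/
theorem nbrw_mixing_larger_than_lsrw_by_log_factor :
    ∃ (D : ℕ) (c : ℝ) (N : ℕ → ℕ) (G : ∀ n, SimpleGraph (Fin (N n))),
      0 < c ∧
      (∀ n, (G n).Connected) ∧
      (∀ n v, 2 ≤ deg (G n) v ∧ deg (G n) v ≤ D) ∧
      Tendsto N atTop atTop ∧
      ∀ n, c * Real.log (N n) * (tmixG (G n) (1/4) : ℝ) ≤
        (mixTime (nbrwMat (G n)) (nbrwSta (G n)) (1/4) : ℝ) := by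
  have hS : ∀ n, Fact (GoodSize (2 * (n + 32))) := fun n => ⟨goodSize_two_mul n⟩
  refine ⟨6, 1 / 10 ^ 8, fun n => gSize (2 * (n + 32)), fun n => gGraph (2 * (n + 32)),
    by norm_num, fun n => connected_gGraph, fun n v => ⟨two_le_deg v, deg_le_six v⟩, ?_,
    fun n => log_mul_tmixG_le⟩
  refine tendsto_atTop_mono (fun n => ?_) tendsto_id
  calc n ≤ 2 * (2 * (n + 32)) := by omega
    _ ≤ 3 ^ (2 * (2 * (n + 32))) := (Nat.lt_pow_self (by norm_num)).le
    _ ≤ gSize (2 * (n + 32)) := pow_le_gSize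

end
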